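/- arXiv:0909.0210 — 2 statements merged into one kernel-verified Lean document; each statement's English description precedes it below -/
import Mathlib

section
/- Fix t ∈ ℝ. For every 𝐢 ∈ Σ and k ∈ ℕ, writing l = l(k), one has the exact identity μ(R_k(𝐢))^t = Σ_{(d_1,…,d_k)∈Γ_k(𝐢)} (p_{d_1}⋯p_{d_k})^t ω(d_{l+1})⋯ω(d_k). -/
open MeasureTheory Metric Real Set Filter
open scoped ENNReal Topology

noncomputable section BedfordMcMullen

/-- `σ = log m / log n`. -/
def sig (m n : ℕ) : ℝ := Real.log m / Real.log n

/-- `l(k) = ⌊σ k⌋`. -/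
def lk (m n k : ℕ) : ℕ := ⌊sig m n * k⌋₊

/-- The affine contraction `T_{i,j}(x,y) = ((x+j)/n, (y+i)/m)` for the digit `d = (i,j)`. -/
def Tmap (m n : ℕ) (d : ℕ × ℕ) (x : ℝ × ℝ) : ℝ × ℝ :=
  ((x.1 + d.2) / n, (x.2 + d.1) / m)

/-- `Λ` is the Bedford–McMullen carpet: the unique nonempty compact set with
`Λ = ⋃_{d ∈ D} T_d(Λ)`. -/
def IsAttractor (m n : ℕ) (D : Finset (ℕ × ℕ)) (Λ : Set (ℝ × ℝ)) : Prop :=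
  IsCompact Λ ∧ Λ.Nonempty ∧ Λ = ⋃ d ∈ D, Tmap m n d '' Λ

/-- `μ` is the self-affine (Bernoulli) measure with weights `p`. -/
def IsSelfAffine (m n : ℕ) (D : Finset (ℕ × ℕ)) (p : ℕ × ℕ → ℝ)
    (μ : Measure (ℝ × ℝ)) : Prop :=
  ∀ A : Set (ℝ × ℝ), MeasurableSet A →
    μ A = ∑ d ∈ D, ENNReal.ofReal (p d) * μ (Tmap m n d ⁻¹' A)

/-- `q_i = Σ_{j : (i,j) ∈ D} p_{ij}`. -/
def qrow (D : Finset (ℕ × ℕ)) (p : ℕ × ℕ → ℝ) (i : ℕ) : ℝ :=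
  ∑ d ∈ D.filter fun d => d.1 = i, p d

/-- `γ_i(t) = Σ_{j : (i,j) ∈ D} p_{ij}^t`. -/
def gam (D : Finset (ℕ × ℕ)) (p : ℕ × ℕ → ℝ) (t : ℝ) (i : ℕ) : ℝ :=
  ∑ d ∈ D.filter fun d => d.1 = i, p d ^ t

/-- `β` satisfies, for every `t`, the defining equation
`m^{β(t)} Σ_{(i,j)∈D} p_{ij}^t q_i^{(1-σ)t} γ_i^{σ-1} = 1`. -/
def IsBeta (m n : ℕ) (D : Finset (ℕ × ℕ)) (p : ℕ × ℕ → ℝ) (β : ℝ → ℝ) : Prop :=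
  ∀ t : ℝ, (m : ℝ) ^ β t *
      ∑ d ∈ D, p d ^ t * qrow D p d.1 ^ ((1 - sig m n) * t) * gam D p t d.1 ^ (sig m n - 1) = 1

/-- The local dimension of `μ` at `x` exists and equals `α`. -/
def HasLocalDim (μ : Measure (ℝ × ℝ)) (x : ℝ × ℝ) (α : ℝ) : Prop :=
  Tendsto (fun r : ℝ => Real.log (μ (ball x r)).toReal / Real.log r) (𝓝[>] 0) (𝓝 α)

/-- `X_α = {x ∈ Λ : d_μ(x) = α}`. -/
def levelSet (μ : Measure (ℝ × ℝ)) (Λ : Set (ℝ × ℝ)) (α : ℝ) : Set (ℝ × ℝ) :=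
  {x | x ∈ Λ ∧ HasLocalDim μ x α}

/-- `α_min = min_{(i,j)∈D} (−σ log p_{ij} + (σ−1) log q_i)/log m`. -/
def alphaMin (m : ℕ) (D : Finset (ℕ × ℕ)) (p : ℕ × ℕ → ℝ) (σ : ℝ) : ℝ :=
  sInf ((fun d => (-σ * Real.log (p d) + (σ - 1) * Real.log (qrow D p d.1)) / Real.log m) ''
    (D : Set (ℕ × ℕ)))

/-- `α_max = max_{(i,j)∈D} (−σ log p_{ij} + (σ−1) log q_i)/log m`. -/
def alphaMax (m : ℕ) (D : Finset (ℕ × ℕ)) (p : ℕ × ℕ → ℝ) (σ : ℝ) : ℝ :=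
  sSup ((fun d => (-σ * Real.log (p d) + (σ - 1) * Real.log (qrow D p d.1)) / Real.log m) ''
    (D : Set (ℕ × ℕ)))

/-- A digit of `D`. -/
abbrev Digit (D : Finset (ℕ × ℕ)) := {d : ℕ × ℕ // d ∈ D}

/-- The symbol space `Σ = D^ℕ` (indexed from `0`; position `r` of the paper is index `r-1`). -/
abbrev Word (D : Finset (ℕ × ℕ)) := ℕ → Digit D

/-- The natural projection `Π : Σ → ℝ²`. -/
def proj (m n : ℕ) {D : Finset (ℕ × ℕ)} (i : Word D) : ℝ × ℝ :=
  (∑' k : ℕ, ((i k).1.2 : ℝ) * (n : ℝ) ^ (-(k + 1 : ℤ)),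
   ∑' k : ℕ, ((i k).1.1 : ℝ) * (m : ℝ) ^ (-(k + 1 : ℤ)))

/-- The approximate square `R_k(𝐢)`. -/
def approxSq (m n : ℕ) {D : Finset (ℕ × ℕ)} (k : ℕ) (i : Word D) : Set (ℝ × ℝ) :=
  Icc (∑ r ∈ Finset.range (lk m n k), ((i r).1.2 : ℝ) * (n : ℝ) ^ (-(r + 1 : ℤ)))
      (∑ r ∈ Finset.range (lk m n k), ((i r).1.2 : ℝ) * (n : ℝ) ^ (-(r + 1 : ℤ)) +
        (n : ℝ) ^ (-(lk m n k : ℤ))) ×ˢ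
  Icc (∑ r ∈ Finset.range k, ((i r).1.1 : ℝ) * (m : ℝ) ^ (-(r + 1 : ℤ)))
      (∑ r ∈ Finset.range k, ((i r).1.1 : ℝ) * (m : ℝ) ^ (-(r + 1 : ℤ)) + (m : ℝ) ^ (-(k : ℤ)))

/-- `D₁ = √(n² + 1)`. -/
def D1 (n : ℕ) : ℝ := Real.sqrt ((n : ℝ) ^ 2 + 1)

/-- The symbolic local dimension of `μ` along `𝐢` exists and equals `α`. -/
def HasSymbDim (m n : ℕ) {D : Finset (ℕ × ℕ)} (μ : Measure (ℝ × ℝ)) (i : Word D)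
    (α : ℝ) : Prop :=
  Tendsto (fun k : ℕ => -Real.log (μ (approxSq m n k i)).toReal / ((k : ℝ) * Real.log m))
    atTop (𝓝 α)

/-- `R_k(𝐢) ∈ Y(α, ε, k)`, i.e. `m^{-kα(1+ε)} ≤ μ(R_k(𝐢)) ≤ m^{-kα(1-ε)}`. -/
def MemY (m n : ℕ) {D : Finset (ℕ × ℕ)} (μ : Measure (ℝ × ℝ)) (α ε : ℝ) (k : ℕ)
    (i : Word D) : Prop :=
  ENNReal.ofReal ((m : ℝ) ^ (-((k : ℝ) * α * (1 + ε)))) ≤ μ (approxSq m n k i) ∧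
    μ (approxSq m n k i) ≤ ENNReal.ofReal ((m : ℝ) ^ (-((k : ℝ) * α * (1 - ε))))

/-- `P_{ij} = p_{ij}^t m^{β(t)} q_i^{(1−σ)t} γ_i^{σ−1}`. -/
def Pweight (m n : ℕ) (D : Finset (ℕ × ℕ)) (p : ℕ × ℕ → ℝ) (β : ℝ → ℝ) (t : ℝ)
    (d : ℕ × ℕ) : ℝ :=
  p d ^ t * (m : ℝ) ^ β t * qrow D p d.1 ^ ((1 - sig m n) * t) * gam D p t d.1 ^ (sig m n - 1)

/-- `Q_i = Σ_{j : (i,j) ∈ D} P_{ij}`. -/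
def Qrow (m n : ℕ) (D : Finset (ℕ × ℕ)) (p : ℕ × ℕ → ℝ) (β : ℝ → ℝ) (t : ℝ) (i : ℕ) : ℝ :=
  ∑ d ∈ D.filter fun d => d.1 = i, Pweight m n D p β t d

/-- `α(t) = (−σ Σ P_{ij} log p_{ij} − (1−σ) Σ Q_i log q_i)/log m`. -/
def alphaT (m n : ℕ) (D : Finset (ℕ × ℕ)) (p : ℕ × ℕ → ℝ) (β : ℝ → ℝ) (t : ℝ) : ℝ :=
  (-(sig m n) * ∑ d ∈ D, Pweight m n D p β t d * Real.log (p d) -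
      (1 - sig m n) * ∑ i ∈ Finset.range m, Qrow m n D p β t i * Real.log (qrow D p i)) /
    Real.log m

/-- `ν` is the Bernoulli (i.i.d. product) measure on `Σ = D^ℕ` with weights `P`. -/
def IsBernoulli {D : Finset (ℕ × ℕ)} (P : ℕ × ℕ → ℝ) (ν : Measure (Word D)) : Prop :=
  ∀ (k : ℕ) (w : Word D),
    ν {i : Word D | ∀ r < k, i r = w r} = ∏ r ∈ Finset.range k, ENNReal.ofReal (P (w r).1)

/-- `Z_k(𝐢)` (with the convention `inf ∅ = ∞`). -/
def Zk (m n : ℕ) {D : Finset (ℕ × ℕ)} (i : Word D) (k : ℕ) : ℝ≥0∞ :=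
  max (⨅ η ∈ {η : ℕ | 1 ≤ η ∧ (i (k + η - 1)).1.1 ≠ (i k).1.1}, (η : ℝ≥0∞))
    (ENNReal.ofReal (sig m n)⁻¹ *
      ⨅ η ∈ {η : ℕ | 1 ≤ η ∧ (i (lk m n k + η - 1)).1.2 ≠ (i (lk m n k)).1.2}, (η : ℝ≥0∞))

/-- `V_k(𝐢) = inf{l > k : row(i_l) ∉ {0, m−1} or row(i_l) ≠ row(i_{k+1})} − k − 1`. -/
def Vk (m : ℕ) {D : Finset (ℕ × ℕ)} (i : Word D) (k : ℕ) : ℝ≥0∞ :=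
  (⨅ l ∈ {l : ℕ | k < l ∧
      ((i (l - 1)).1.1 ∉ ({0, m - 1} : Set ℕ) ∨ (i (l - 1)).1.1 ≠ (i k).1.1)}, (l : ℝ≥0∞)) -
    ((k : ℝ≥0∞) + 1)

/-- `ω(i,j) = q_i^t γ_i^{−1}`. -/
def omg (D : Finset (ℕ × ℕ)) (p : ℕ × ℕ → ℝ) (t : ℝ) (d : ℕ × ℕ) : ℝ :=
  qrow D p d.1 ^ t * (gam D p t d.1)⁻¹

/-- `B_l(𝐢) = (1/l) Σ_{r=1}^l log ω(i_r)`. -/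
def Bl {D : Finset (ℕ × ℕ)} (p : ℕ × ℕ → ℝ) (t : ℝ) (i : Word D) (l : ℕ) : ℝ :=
  (1 / (l : ℝ)) * ∑ r ∈ Finset.range l, Real.log (omg D p t (i r).1)

/-- `A_k(𝐢) = B_{l(k)}(𝐢) − B_k(𝐢)`. -/
def Ak (m n : ℕ) {D : Finset (ℕ × ℕ)} (p : ℕ × ℕ → ℝ) (t : ℝ) (i : Word D) (k : ℕ) : ℝ :=
  Bl p t i (lk m n k) - Bl p t i k

/-- `R_k(𝐢) ∈ G(α, ε, k) = Y(α,ε,k) ∩ {A_k ≥ −log(1+ε)}`. -/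
def MemG (m n : ℕ) {D : Finset (ℕ × ℕ)} (μ : Measure (ℝ × ℝ)) (p : ℕ × ℕ → ℝ)
    (t α ε : ℝ) (k : ℕ) (i : Word D) : Prop :=
  MemY m n μ α ε k i ∧ -Real.log (1 + ε) ≤ Ak m n p t i k

open Classical in
/-- `Γ_k(𝐢)`: words of length `k` agreeing with `𝐢` on the first `l(k)` digits and with the
rows of `𝐢` on the remaining digits. -/
def GammaSet (m n : ℕ) {D : Finset (ℕ × ℕ)} (k : ℕ) (i : Word D) :
    Finset (Fin k → Digit D) :=
  Finset.univ.filter fun w =>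
    (∀ r : Fin k, (r : ℕ) < lk m n k → w r = i r) ∧
      ∀ r : Fin k, lk m n k ≤ (r : ℕ) → (w r).1.1 = (i (r : ℕ)).1.1

/-- `R̂_k(𝐢)`: the rectangle with the same center as `R_k(𝐢)` whose sides are `2D₁` times
longer. -/
def hatRect (m n : ℕ) {D : Finset (ℕ × ℕ)} (k : ℕ) (i : Word D) : Set (ℝ × ℝ) :=
  Icc (∑ r ∈ Finset.range (lk m n k), ((i r).1.2 : ℝ) * (n : ℝ) ^ (-(r + 1 : ℤ)) +
        (n : ℝ) ^ (-(lk m n k : ℤ)) / 2 - D1 n * (n : ℝ) ^ (-(lk m n k : ℤ)))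
      (∑ r ∈ Finset.range (lk m n k), ((i r).1.2 : ℝ) * (n : ℝ) ^ (-(r + 1 : ℤ)) +
        (n : ℝ) ^ (-(lk m n k : ℤ)) / 2 + D1 n * (n : ℝ) ^ (-(lk m n k : ℤ))) ×ˢ
  Icc (∑ r ∈ Finset.range k, ((i r).1.1 : ℝ) * (m : ℝ) ^ (-(r + 1 : ℤ)) +
        (m : ℝ) ^ (-(k : ℤ)) / 2 - D1 n * (m : ℝ) ^ (-(k : ℤ)))
      (∑ r ∈ Finset.range k, ((i r).1.1 : ℝ) * (m : ℝ) ^ (-(r + 1 : ℤ)) +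
        (m : ℝ) ^ (-(k : ℤ)) / 2 + D1 n * (m : ℝ) ^ (-(k : ℤ)))

/-! ### Helper lemmas -/

lemma aux_zero {ι : Type*} (D : Finset ι) (p : ι → ℝ) (hp : ∀ d ∈ D, 0 < p d)
    (hp1 : ∑ d ∈ D, p d = 1) (b : ℝ) (hb : 2 ≤ b) (c : ι → ℝ) (hc : ∀ d ∈ D, 0 ≤ c d)
    (hc' : ∃ d ∈ D, 0 < c d) (G : ℝ → ℝ) (hmono : Monotone G) (hnn : ∀ s, 0 ≤ G s)
    (hlim : Tendsto G atBot (𝓝 0))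
    (hG : ∀ s, G s = ∑ d ∈ D, p d * G (b * s - c d)) : G 0 = 0 := by
  have hle : ∀ s, G s ≤ G (b * s) := by
    intro s
    rw [hG s]
    calc ∑ d ∈ D, p d * G (b * s - c d) ≤ ∑ d ∈ D, p d * G (b * s) := by
          apply Finset.sum_le_sum
          intro d hd
          apply mul_le_mul_of_nonneg_left _ (hp d hd).le
          apply hmono
          linarith [hc d hd]
      _ = G (b * s) := by rw [← Finset.sum_mul, hp1, one_mul]
  have hpow : ∀ s (k : ℕ), G s ≤ G (b ^ k * s) := by
    intro s k
    induction k with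
    | zero => simp
    | succ k ih =>
      refine ih.trans ((hle _).trans (le_of_eq ?_))
      congr 1
      ring
  have hneg : ∀ s < 0, G s = 0 := by
    intro s hs
    apply le_antisymm _ (hnn s)
    have h1 : Tendsto (fun k : ℕ => b ^ k * s) atTop atBot :=
      (tendsto_pow_atTop_atTop_of_one_lt (by linarith)).atTop_mul_const_of_neg hs
    exact ge_of_tendsto' (hlim.comp h1) (fun k => hpow s k)
  obtain ⟨d0, hd0, hcd0⟩ := hc'
  classical
  have h0 := hG 0
  have : ∑ d ∈ D, p d * G (b * 0 - c d) ≤ ∑ d ∈ D, (p d * G 0 - if d0 = d then p d * G 0 else 0) := by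
    apply Finset.sum_le_sum
    intro d hd
    split_ifs with h
    · subst h
      rw [hneg _ (by linarith)]
      simp
    · rw [sub_zero]
      apply mul_le_mul_of_nonneg_left _ (hp d hd).le
      apply hmono
      linarith [hc d hd]
  rw [← h0, Finset.sum_sub_distrib, ← Finset.sum_mul, hp1, Finset.sum_ite_eq, if_pos hd0] at this
  have h2 := hp d0 hd0
  have h3 := hnn 0
  nlinarith

lemma selfAffine_real {m n : ℕ} {D : Finset (ℕ × ℕ)} {p : ℕ × ℕ → ℝ} (hp : ∀ d ∈ D, 0 < p d)
    {μ : Measure (ℝ × ℝ)} [IsProbabilityMeasure μ] (hμ : IsSelfAffine m n D p μ)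
    {A : Set (ℝ × ℝ)} (hA : MeasurableSet A) :
    μ.real A = ∑ d ∈ D, p d * μ.real (Tmap m n d ⁻¹' A) := by
  unfold Measure.real
  rw [hμ A hA, ENNReal.toReal_sum]
  · apply Finset.sum_congr rfl
    intro d hd
    rw [ENNReal.toReal_mul, ENNReal.toReal_ofReal (hp d hd).le]
  · intro d hd
    exact ENNReal.mul_ne_top ENNReal.ofReal_ne_top (measure_ne_top _ _)

lemma tendsto_Iic_real {μ : Measure (ℝ × ℝ)} [IsProbabilityMeasure μ] {f : ℝ × ℝ → ℝ}
    (hf : Measurable f) : Tendsto (fun s => μ.real {x | f x ≤ s}) atBot (𝓝 0) := by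
  have : Tendsto (fun s => μ {x | f x ≤ s}) atBot (𝓝 (μ (⋂ s, {x | f x ≤ s}))) := by
    apply tendsto_measure_iInter_atBot
    · intro s
      exact (measurableSet_le hf measurable_const).nullMeasurableSet
    · intro a b hab x hx
      exact le_trans hx hab
    · exact ⟨0, measure_ne_top _ _⟩
  have h0 : (⋂ s, {x | f x ≤ s}) = ∅ := by
    ext x
    simp only [mem_iInter, mem_setOf_eq, mem_empty_iff_false, iff_false, not_forall, not_le]
    exact ⟨f x - 1, by linarith⟩
  rw [h0, measure_empty] at this
  have := (ENNReal.tendsto_toReal ENNReal.zero_ne_top).comp this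
  exact this

lemma null_of_affine {m n : ℕ} {D : Finset (ℕ × ℕ)} {p : ℕ × ℕ → ℝ} (hp : ∀ d ∈ D, 0 < p d)
    (hp1 : ∑ d ∈ D, p d = 1)
    {μ : Measure (ℝ × ℝ)} [IsProbabilityMeasure μ] (hμ : IsSelfAffine m n D p μ)
    (f : ℝ × ℝ → ℝ) (hf : Measurable f) (b : ℝ) (hb : 2 ≤ b) (c : ℕ × ℕ → ℝ)
    (hc : ∀ d ∈ D, 0 ≤ c d) (hc' : ∃ d ∈ D, 0 < c d)
    (hfT : ∀ d ∈ D, ∀ x, f (Tmap m n d x) = (f x + c d) / b) :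
    ∀ᵐ x ∂μ, 0 < f x := by
  have h := aux_zero D p hp hp1 b hb c hc hc' (fun s => μ.real {x | f x ≤ s})
    (by
      intro s s' hs
      exact measureReal_mono (fun x hx => le_trans hx hs))
    (fun s => measureReal_nonneg) (tendsto_Iic_real hf)
    (by
      intro s
      rw [selfAffine_real hp hμ (measurableSet_le hf measurable_const)]
      apply Finset.sum_congr rfl
      intro d hd
      congr 2
      ext x
      simp only [mem_preimage, mem_setOf_eq]
      rw [hfT d hd, div_le_iff₀ (by linarith), le_sub_iff_add_le, mul_comm])
  rw [measureReal_eq_zero_iff] at h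
  rw [ae_iff]
  simpa using h

lemma ae_unit {m n : ℕ} (hm : 2 ≤ m) (hmn : m < n)
    {D : Finset (ℕ × ℕ)} (hD : ∀ d ∈ D, d.1 < m ∧ d.2 < n)
    (hrow : ∃ d ∈ D, ∃ d' ∈ D, d.1 ≠ d'.1)
    (hcol : ∃ d ∈ D, ∃ d' ∈ D, d.2 ≠ d'.2)
    {p : ℕ × ℕ → ℝ} (hp : ∀ d ∈ D, 0 < p d) (hp1 : ∑ d ∈ D, p d = 1)
    {μ : Measure (ℝ × ℝ)} [IsProbabilityMeasure μ] (hμ : IsSelfAffine m n D p μ) :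
    ∀ᵐ x ∂μ, x.1 ∈ Ioo (0:ℝ) 1 ∧ x.2 ∈ Ioo (0:ℝ) 1 := by
  have hm' : (2:ℝ) ≤ m := by exact_mod_cast hm
  have hn' : (2:ℝ) ≤ n := by exact_mod_cast (by omega : 2 ≤ n)
  have hm0 : (m:ℝ) ≠ 0 := by linarith
  have hn0 : (n:ℝ) ≠ 0 := by linarith
  have hD1 : ∀ d ∈ D, (d.1:ℝ) + 1 ≤ m := fun d hd => by exact_mod_cast (hD d hd).1
  have hD2 : ∀ d ∈ D, (d.2:ℝ) + 1 ≤ n := fun d hd => by exact_mod_cast (hD d hd).2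
  have hr : ∃ d ∈ D, ∃ d' ∈ D, d.1 < d'.1 := by
    obtain ⟨d, hd, d', hd', h⟩ := hrow
    rcases lt_or_gt_of_ne h with h | h
    · exact ⟨d, hd, d', hd', h⟩
    · exact ⟨d', hd', d, hd, h⟩
  have hcl : ∃ d ∈ D, ∃ d' ∈ D, d.2 < d'.2 := by
    obtain ⟨d, hd, d', hd', h⟩ := hcol
    rcases lt_or_gt_of_ne h with h | h
    · exact ⟨d, hd, d', hd', h⟩
    · exact ⟨d', hd', d, hd, h⟩
  obtain ⟨r, hrD, r', hrD', hrr⟩ := hr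
  obtain ⟨s, hsD, s', hsD', hss⟩ := hcl
  have hrr' : (r.1:ℝ) < r'.1 := by exact_mod_cast hrr
  have hss' : (s.2:ℝ) < s'.2 := by exact_mod_cast hss
  have h1 := null_of_affine hp hp1 hμ (fun x => x.1) measurable_fst n hn' (fun d => d.2)
    (fun d hd => by positivity) ⟨s', hsD', lt_of_le_of_lt (by positivity) hss'⟩
    (fun d hd x => rfl)
  have h2 := null_of_affine hp hp1 hμ (fun x => x.2) measurable_snd m hm' (fun d => d.1)
    (fun d hd => by positivity) ⟨r', hrD', lt_of_le_of_lt (by positivity) hrr'⟩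
    (fun d hd x => rfl)
  have h3 := null_of_affine hp hp1 hμ (fun x => 1 - x.1) (measurable_const.sub measurable_fst)
    n hn' (fun d => n - 1 - d.2)
    (fun d hd => by linarith [hD2 d hd]) ⟨s, hsD, by linarith [hD2 s' hsD']⟩
    (fun d hd x => by simp only [Tmap]; field_simp; ring)
  have h4 := null_of_affine hp hp1 hμ (fun x => 1 - x.2) (measurable_const.sub measurable_snd)
    m hm' (fun d => m - 1 - d.1)
    (fun d hd => by linarith [hD1 d hd]) ⟨r, hrD, by linarith [hD1 r' hrD']⟩
    (fun d hd x => by simp only [Tmap]; field_simp; ring)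
  filter_upwards [h1, h2, h3, h4] with x a1 a2 a3 a4
  exact ⟨⟨a1, by linarith⟩, ⟨a2, by linarith⟩⟩

/-- The `b`-adic interval of depth `l` with digits `f`. -/
def adic (b l : ℕ) (f : ℕ → ℕ) : Set ℝ :=
  Icc (∑ r ∈ Finset.range l, (f r : ℝ) * (b : ℝ) ^ (-(r + 1 : ℤ)))
      (∑ r ∈ Finset.range l, (f r : ℝ) * (b : ℝ) ^ (-(r + 1 : ℤ)) + (b : ℝ) ^ (-(l : ℤ)))

lemma adic_sum_succ (b l : ℕ) (hb : 2 ≤ b) (f : ℕ → ℕ) :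
    ∑ r ∈ Finset.range (l + 1), (f r : ℝ) * (b : ℝ) ^ (-(r + 1 : ℤ)) =
      (f 0 + ∑ r ∈ Finset.range l, (f (r + 1) : ℝ) * (b : ℝ) ^ (-(r + 1 : ℤ))) / b := by
  have hb0 : (b:ℝ) ≠ 0 := by positivity
  rw [Finset.sum_range_succ', add_comm, add_div, Finset.sum_div]
  congr 1
  · simp [zpow_neg, div_eq_mul_inv]
  · apply Finset.sum_congr rfl
    intro r _
    rw [mul_div_assoc, div_eq_mul_inv, ← zpow_neg_one, ← zpow_add₀ hb0]
    congr 2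

lemma adic_pow_succ (b l : ℕ) (hb : 2 ≤ b) :
    (b : ℝ) ^ (-((l + 1 : ℕ) : ℤ)) = (b : ℝ) ^ (-(l : ℤ)) / b := by
  have hb0 : (b:ℝ) ≠ 0 := by positivity
  rw [div_eq_mul_inv, ← zpow_neg_one, ← zpow_add₀ hb0]
  congr 1
  push_cast
  ring

lemma adic_bound (b l : ℕ) (hb : 2 ≤ b) (f : ℕ → ℕ) (hf : ∀ r, f r < b) :
    ∑ r ∈ Finset.range l, (f r : ℝ) * (b : ℝ) ^ (-(r + 1 : ℤ)) + (b : ℝ) ^ (-(l : ℤ)) ≤ 1 := by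
  have hb0 : (0:ℝ) < b := by positivity
  induction l generalizing f with
  | zero => simp
  | succ l ih =>
    rw [adic_sum_succ b l hb, adic_pow_succ b l hb, ← add_div, div_le_one hb0]
    have h1 := ih (fun r => f (r + 1)) (fun r => hf _)
    have h2 : (f 0 : ℝ) + 1 ≤ b := by exact_mod_cast hf 0
    linarith

lemma adic_nonneg (b l : ℕ) (f : ℕ → ℕ) :
    0 ≤ ∑ r ∈ Finset.range l, (f r : ℝ) * (b : ℝ) ^ (-(r + 1 : ℤ)) :=
  Finset.sum_nonneg fun r _ => by positivity

lemma adic_step (b l c : ℕ) (hb : 2 ≤ b) (f : ℕ → ℕ) (hf : ∀ r, f r < b) {x : ℝ}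
    (hx : x ∈ Ioo (0:ℝ) 1) :
    (x + c) / b ∈ adic b (l + 1) f ↔ c = f 0 ∧ x ∈ adic b l (fun r => f (r + 1)) := by
  have hb0 : (0:ℝ) < b := by positivity
  have h1 := adic_bound b l hb (fun r => f (r + 1)) (fun r => hf _)
  have h2 := adic_nonneg b l (fun r => f (r + 1))
  unfold adic
  simp only at h1 h2 ⊢
  rw [adic_sum_succ b l hb, adic_pow_succ b l hb, ← add_div, mem_Icc, mem_Icc,
    div_le_div_iff_of_pos_right hb0, div_le_div_iff_of_pos_right hb0]
  constructor
  · rintro ⟨h3, h4⟩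
    have hc : c = f 0 := by
      rcases lt_trichotomy c (f 0) with h | h | h
      · have : (c:ℝ) + 1 ≤ f 0 := by exact_mod_cast h
        linarith [hx.1, hx.2]
      · exact h
      · have : (f 0:ℝ) + 1 ≤ c := by exact_mod_cast h
        linarith [hx.1, hx.2]
    subst hc
    exact ⟨rfl, by linarith, by linarith⟩
  · rintro ⟨rfl, h3, h4⟩
    exact ⟨by linarith, by linarith⟩

lemma adic_zero (b : ℕ) (f : ℕ → ℕ) : adic b 0 f = Icc 0 1 := by
  simp [adic]

lemma box_measure {m n : ℕ} (hm : 2 ≤ m) (hmn : m < n)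
    {D : Finset (ℕ × ℕ)} (hD : ∀ d ∈ D, d.1 < m ∧ d.2 < n)
    {p : ℕ × ℕ → ℝ} (hp : ∀ d ∈ D, 0 < p d)
    {μ : Measure (ℝ × ℝ)} [IsProbabilityMeasure μ] (hμ : IsSelfAffine m n D p μ)
    (hae : ∀ᵐ x ∂μ, x.1 ∈ Ioo (0:ℝ) 1 ∧ x.2 ∈ Ioo (0:ℝ) 1) (k : ℕ) :
    ∀ (l : ℕ) (i : Word D), l ≤ k →
    μ.real (adic n l (fun r => (i r).1.2) ×ˢ adic m k (fun r => (i r).1.1)) =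
      ∏ r ∈ Finset.range k, if r < l then p (i r).1 else qrow D p (i r).1.1 := by
  have hn : 2 ≤ n := by omega
  induction k with
  | zero =>
    intro l i hl
    obtain rfl : l = 0 := by omega
    rw [adic_zero, adic_zero, Finset.range_zero, Finset.prod_empty]
    refine Eq.trans ?_ (probReal_univ (μ := μ))
    apply measureReal_congr
    filter_upwards [hae] with x hx
    apply propext
    constructor
    · intro _; trivial
    · intro _
      exact ⟨Ioo_subset_Icc_self hx.1, Ioo_subset_Icc_self hx.2⟩
  | succ k ih =>
    intro l i hl
    have hi1 : ∀ r, (i r).1.1 < m := fun r => (hD _ (i r).2).1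
    have hi2 : ∀ r, (i r).1.2 < n := fun r => (hD _ (i r).2).2
    have hn0 : (0:ℝ) < n := by positivity
    rw [selfAffine_real hp hμ (by unfold adic; exact measurableSet_Icc.prod measurableSet_Icc),
      Finset.prod_range_succ']
    rcases l with _ | l
    · have key : ∀ d ∈ D, p d * μ.real (Tmap m n d ⁻¹'
          (adic n 0 (fun r => (i r).1.2) ×ˢ adic m (k + 1) (fun r => (i r).1.1))) =
          if d.1 = (i 0).1.1 then p d * μ.real (adic n 0 (fun r => (i (r + 1)).1.2) ×ˢ
            adic m k (fun r => (i (r + 1)).1.1)) else 0 := by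
        intro d hd
        have hd2 : (d.2:ℝ) + 1 ≤ n := by exact_mod_cast (hD d hd).2
        split_ifs with h
        · congr 1
          apply measureReal_congr
          filter_upwards [hae] with x hx
          apply propext
          change (_ ∧ _) ↔ (_ ∧ _)
          have := adic_step m k d.1 hm (fun r => (i r).1.1) hi1 hx.2
          simp only [Tmap, this, adic_zero]
          have a1 : x.1 ∈ Icc (0:ℝ) 1 := Ioo_subset_Icc_self hx.1
          have a2 : (x.1 + d.2) / n ∈ Icc (0:ℝ) 1 := by
            have := hx.1.1
            have := hx.1.2
            refine ⟨by positivity, ?_⟩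
            rw [div_le_one hn0]
            linarith
          simp only [a1, a2, h, true_and]
        · rw [mul_eq_zero]
          right
          rw [measureReal_eq_zero_iff, measure_eq_zero_iff_ae_notMem]
          filter_upwards [hae] with x hx hx'
          exact h ((adic_step m k d.1 hm (fun r => (i r).1.1) hi1 hx.2).1 hx'.2).1
      rw [Finset.sum_congr rfl key, ← Finset.sum_filter, ← Finset.sum_mul,
        ih 0 (fun r => i (r + 1)) (by omega), mul_comm]
      simp [qrow]
    · have key : ∀ d ∈ D, p d * μ.real (Tmap m n d ⁻¹'
          (adic n (l + 1) (fun r => (i r).1.2) ×ˢ adic m (k + 1) (fun r => (i r).1.1))) =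
          if d = (i 0).1 then p d * μ.real (adic n l (fun r => (i (r + 1)).1.2) ×ˢ
            adic m k (fun r => (i (r + 1)).1.1)) else 0 := by
        intro d hd
        split_ifs with h
        · congr 1
          apply measureReal_congr
          filter_upwards [hae] with x hx
          apply propext
          change (_ ∧ _) ↔ (_ ∧ _)
          have h1 := adic_step m k d.1 hm (fun r => (i r).1.1) hi1 hx.2
          have h2 := adic_step n l d.2 hn (fun r => (i r).1.2) hi2 hx.1
          simp only [Tmap, h1, h2]
          simp only [h, true_and]
        · rw [mul_eq_zero]
          right
          rw [measureReal_eq_zero_iff, measure_eq_zero_iff_ae_notMem]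
          filter_upwards [hae] with x hx hx'
          exact h (Prod.ext ((adic_step m k d.1 hm (fun r => (i r).1.1) hi1 hx.2).1 hx'.2).1
            ((adic_step n l d.2 hn (fun r => (i r).1.2) hi2 hx.1).1 hx'.1).1)
      rw [Finset.sum_congr rfl key, Finset.sum_ite_eq', if_pos (i 0).2,
        ih l (fun r => i (r + 1)) (by omega), mul_comm]
      simp

lemma lk_le {m n : ℕ} (hm : 2 ≤ m) (hmn : m < n) (k : ℕ) : lk m n k ≤ k := by
  unfold lk
  apply Nat.floor_le_of_le
  have hm1 : (1:ℝ) < m := by exact_mod_cast (by omega : 1 < m)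
  have h : (m:ℝ) ≤ n := by exact_mod_cast hmn.le
  have : sig m n ≤ 1 := by
    unfold sig
    rw [div_le_one (Real.log_pos (by linarith))]
    exact Real.log_le_log (by linarith) h
  have hk : (0:ℝ) ≤ k := by positivity
  nlinarith

lemma sum_digit_filter {D : Finset (ℕ × ℕ)} (a : ℕ) (g : ℕ × ℕ → ℝ) :
    ∑ d ∈ (Finset.univ : Finset (Digit D)).filter (fun d => d.1.1 = a), g d.1 =
      ∑ d ∈ D.filter (fun d => d.1 = a), g d := by
  rw [Finset.sum_filter, Finset.sum_filter]
  exact Finset.sum_coe_sort D (fun d => if d.1 = a then g d else 0)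

theorem measure_power_identity
    (m n : ℕ) (hm : 2 ≤ m) (hmn : m < n)
    (D : Finset (ℕ × ℕ)) (hD : ∀ d ∈ D, d.1 < m ∧ d.2 < n)
    (hrow : ∃ d ∈ D, ∃ d' ∈ D, d.1 ≠ d'.1)
    (hcol : ∃ d ∈ D, ∃ d' ∈ D, d.2 ≠ d'.2)
    (p : ℕ × ℕ → ℝ) (hp : ∀ d ∈ D, 0 < p d) (hp1 : ∑ d ∈ D, p d = 1)
    (μ : Measure (ℝ × ℝ)) (hμ1 : IsProbabilityMeasure μ) (hμ : IsSelfAffine m n D p μ)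
    (Λ : Set (ℝ × ℝ)) (hΛ : IsAttractor m n D Λ)

    (t : ℝ) :
    ∀ (i : Word D) (k : ℕ),
      (μ (approxSq m n k i)).toReal ^ t =
        ∑ w ∈ GammaSet m n k i,
          (∏ r : Fin k, p (w r).1) ^ t *
            ∏ r ∈ Finset.univ.filter (fun r : Fin k => lk m n k ≤ (r : ℕ)),
              omg D p t (w r).1 := by
  intro i k
  have hae := ae_unit hm hmn hD hrow hcol hp hp1 hμ
  have hbox := box_measure hm hmn hD hp hμ hae k (lk m n k) i (lk_le hm hmn k)
  change (μ.real (adic n (lk m n k) (fun r => (i r).1.2) ×ˢ adic m k (fun r => (i r).1.1))) ^ t = _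
  rw [hbox]
  set l := lk m n k with hl
  have hq : ∀ d ∈ D, 0 < qrow D p d.1 := by
    intro d hd
    apply Finset.sum_pos
    · intro e he
      exact hp e (Finset.mem_filter.1 he).1
    · exact ⟨d, Finset.mem_filter.2 ⟨hd, rfl⟩⟩
  have hg : ∀ d ∈ D, 0 < gam D p t d.1 := by
    intro d hd
    apply Finset.sum_pos
    · intro e he
      exact Real.rpow_pos_of_pos (hp e (Finset.mem_filter.1 he).1) _
    · exact ⟨d, Finset.mem_filter.2 ⟨hd, rfl⟩⟩
  rw [← Real.finsetProd_rpow _ _ (by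
    intro r _
    split_ifs
    · exact (hp _ (i r).2).le
    · exact (hq _ (i r).2).le), Finset.prod_range]
  classical
  have hGam : GammaSet m n k i = Fintype.piFinset (fun r : Fin k =>
      if (r:ℕ) < l then {i r} else
        (Finset.univ : Finset (Digit D)).filter (fun d => d.1.1 = (i r).1.1)) := by
    ext w
    simp only [GammaSet, Finset.mem_filter, Finset.mem_univ, true_and, Fintype.mem_piFinset,
      ← hl]
    constructor
    · rintro ⟨h1, h2⟩ r
      split_ifs with h
      · simpa using h1 r h
      · simpa using h2 r (not_lt.1 h)
    · intro h
      constructor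
      · intro r hr
        simpa [hr] using h r
      · intro r hr
        simpa [not_lt.2 hr] using h r
  have hsum : ∀ w ∈ GammaSet m n k i, (∏ r : Fin k, p (w r).1) ^ t *
      ∏ r ∈ Finset.univ.filter (fun r : Fin k => l ≤ (r : ℕ)), omg D p t (w r).1 =
      ∏ r : Fin k, (p (w r).1 ^ t * if l ≤ (r:ℕ) then omg D p t (w r).1 else 1) := by
    intro w _
    rw [← Real.finsetProd_rpow _ _ (fun r _ => (hp _ (w r).2).le), Finset.prod_mul_distrib,
      Finset.prod_filter]
  rw [Finset.sum_congr rfl hsum, hGam,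
    ← Finset.prod_univ_sum _ (fun (r : Fin k) (d : Digit D) =>
      p d.1 ^ t * if l ≤ (r:ℕ) then omg D p t d.1 else 1)]
  apply Finset.prod_congr rfl
  intro r _
  by_cases h : (r:ℕ) < l
  · simp [h, not_le.2 h]
  · rw [if_neg h, if_neg h]
    simp only [not_lt.1 h, if_true]
    have : ∀ d ∈ (Finset.univ : Finset (Digit D)).filter (fun d => d.1.1 = (i r).1.1),
        p d.1 ^ t * omg D p t d.1 = p d.1 ^ t * omg D p t (i r).1 := by
      intro d hd
      simp only [omg, (Finset.mem_filter.1 hd).2]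
    rw [Finset.sum_congr rfl this, ← Finset.sum_mul, sum_digit_filter _ (fun d => p d ^ t)]
    change _ = gam D p t (i r).1.1 * _
    have := hg _ (i r).2
    unfold omg
    field_simp

end BedfordMcMullen
end

section
/- Fix t ∈ ℝ. For every α ∈ ℝ, ε > 0 and K ∈ ℕ, X_α ⊆ ∪_{k>K} ∪_{R_k(𝐢) ∈ G(α,ε,k)} R̂_k(𝐢), where R̂_k(𝐢) denotes the rectangle with the same center as R_k(𝐢) whose sides are 2D₁ times longer. -/
open MeasureTheory Metric Real Set Filter
open scoped ENNReal Topology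

noncomputable section BedfordMcMullen

lemma bm_dist_Tmap (m n : ℕ) (hm : 2 ≤ m) (hmn : m < n) (d : ℕ × ℕ) (x y : ℝ × ℝ) :
    dist (Tmap m n d x) (Tmap m n d y) ≤ dist x y / m := by
  have hm0 : (0:ℝ) < m := by positivity
  have hn0 : (0:ℝ) < n := by
    have : 0 < n := by omega
    exact_mod_cast this
  have hmn' : (m:ℝ) ≤ n := by exact_mod_cast hmn.le
  rw [Prod.dist_eq, Prod.dist_eq]
  simp only [Tmap, Real.dist_eq]
  apply max_le
  · have : (x.1 + d.2) / n - (y.1 + d.2) / n = (x.1 - y.1) / n := by ring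
    rw [this, abs_div, abs_of_pos hn0]
    gcongr
    exact le_max_left _ _
  · have : (x.2 + d.1) / m - (y.2 + d.1) / m = (x.2 - y.2) / m := by ring
    rw [this, abs_div, abs_of_pos hm0]
    gcongr
    exact le_max_right _ _

lemma bm_Tmap_cont (m n : ℕ) (d : ℕ × ℕ) : Continuous (Tmap m n d) := by
  unfold Tmap
  fun_prop

lemma bm_sum_p (D : Finset (ℕ × ℕ)) (p : ℕ × ℕ → ℝ) (hp : ∀ d ∈ D, 0 < p d)
    (hp1 : ∑ d ∈ D, p d = 1) : ∑ d ∈ D, ENNReal.ofReal (p d) = 1 := by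
  rw [← ENNReal.ofReal_sum_of_nonneg (fun d hd => (hp d hd).le), hp1, ENNReal.ofReal_one]

lemma bm_inv_mem {m n : ℕ} {D : Finset (ℕ × ℕ)} {Λ : Set (ℝ × ℝ)} (hΛ : IsAttractor m n D Λ)
    {d : ℕ × ℕ} (hd : d ∈ D) {x : ℝ × ℝ} (hx : x ∈ Λ) : Tmap m n d x ∈ Λ := by
  rw [hΛ.2.2]
  simp only [mem_iUnion]
  exact ⟨d, hd, x, hx, rfl⟩

lemma bm_exists_pre {m n : ℕ} {D : Finset (ℕ × ℕ)} {Λ : Set (ℝ × ℝ)} (hΛ : IsAttractor m n D Λ)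
    {x : ℝ × ℝ} (hx : x ∈ Λ) : ∃ d ∈ D, ∃ y ∈ Λ, x = Tmap m n d y := by
  rw [hΛ.2.2] at hx
  simp only [mem_iUnion] at hx
  obtain ⟨d, hd, y, hy, h⟩ := hx
  exact ⟨d, hd, y, hy, h.symm⟩

/-- `μ` is carried by `Λ`. -/
lemma bm_full (m n : ℕ) (hm : 2 ≤ m) (hmn : m < n)
    (D : Finset (ℕ × ℕ))
    (p : ℕ × ℕ → ℝ) (hp : ∀ d ∈ D, 0 < p d) (hp1 : ∑ d ∈ D, p d = 1)
    (μ : Measure (ℝ × ℝ)) (hμ1 : IsProbabilityMeasure μ) (hμ : IsSelfAffine m n D p μ)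
    (Λ : Set (ℝ × ℝ)) (hΛ : IsAttractor m n D Λ) : μ Λᶜ = 0 := by
  have hm0 : (0:ℝ) < m := by positivity
  have hcl : IsClosed Λ := hΛ.1.isClosed
  have step : ∀ R : ℝ, 0 ≤ R → μ (cthickening R Λ) ≤ μ (cthickening (R / m) Λ) := by
    intro R hR
    rw [hμ (cthickening (R / m) Λ) isClosed_cthickening.measurableSet]
    calc μ (cthickening R Λ) = ∑ d ∈ D, ENNReal.ofReal (p d) * μ (cthickening R Λ) := by
          rw [← Finset.sum_mul, bm_sum_p D p hp hp1, one_mul]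
      _ ≤ _ := by
          apply Finset.sum_le_sum
          intro d hd
          gcongr
          intro x hx
          rw [hΛ.1.cthickening_eq_biUnion_closedBall hR] at hx
          simp only [mem_iUnion, mem_closedBall] at hx
          obtain ⟨y, hy, hxy⟩ := hx
          refine mem_cthickening_of_dist_le _ (Tmap m n d y) _ _ (bm_inv_mem hΛ hd hy) ?_
          refine (bm_dist_Tmap m n hm hmn d x y).trans ?_
          gcongr
  have step2 : ∀ R : ℝ, 0 ≤ R → ∀ k : ℕ,
      μ (cthickening R Λ) ≤ μ (cthickening (R / (m:ℝ) ^ k) Λ) := by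
    intro R hR k
    induction k with
    | zero => simp
    | succ k ih =>
      refine ih.trans ((step _ (by positivity)).trans ?_)
      rw [div_div, pow_succ]
  have step3 : ∀ R : ℝ, 0 ≤ R → μ (cthickening R Λ) ≤ μ Λ := by
    intro R hR
    have h1 : Tendsto (fun k : ℕ => R / (m:ℝ) ^ k) atTop (𝓝 0) := by
      have : Tendsto (fun k : ℕ => R * ((m:ℝ)⁻¹) ^ k) atTop (𝓝 (R * 0)) := by
        apply Tendsto.const_mul
        apply tendsto_pow_atTop_nhds_zero_of_lt_one (by positivity)
        apply inv_lt_one_of_one_lt₀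
        exact_mod_cast (by omega : 1 < m)
      simpa [div_eq_mul_inv] using this
    have h2 := (tendsto_measure_cthickening_of_isCompact (μ := μ) hΛ.1).comp h1
    exact ge_of_tendsto' h2 (fun k => step2 R hR k)
  obtain ⟨y0, hy0⟩ := hΛ.2.1
  have h4 : ∀ N : ℕ, μ (closedBall y0 N) ≤ μ Λ := by
    intro N
    refine le_trans (measure_mono ?_) (step3 N (by positivity))
    exact closedBall_subset_cthickening hy0 _
  have h5 : Tendsto (fun N : ℕ => μ (closedBall y0 (N:ℝ))) atTop
      (𝓝 (μ (⋃ N : ℕ, closedBall y0 (N:ℝ)))) := by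
    apply tendsto_measure_iUnion_atTop
    intro a b hab
    exact closedBall_subset_closedBall (by exact_mod_cast hab)
  rw [iUnion_closedBall_nat, measure_univ] at h5
  have h6 : 1 ≤ μ Λ := le_of_tendsto' h5 h4
  rw [prob_compl_eq_zero_iff hcl.measurableSet]
  exact le_antisymm prob_le_one h6

lemma bm_unit (m n : ℕ) (hm : 2 ≤ m) (hmn : m < n)
    (D : Finset (ℕ × ℕ)) (hD : ∀ d ∈ D, d.1 < m ∧ d.2 < n)
    (Λ : Set (ℝ × ℝ)) (hΛ : IsAttractor m n D Λ) :
    ∀ x ∈ Λ, (0 ≤ x.1 ∧ x.1 ≤ 1) ∧ (0 ≤ x.2 ∧ x.2 ≤ 1) := by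
  have aux : ∀ (f : ℝ × ℝ → ℝ), Continuous f → ∀ (b : ℕ), 2 ≤ b →
      (∀ x ∈ Λ, ∃ y ∈ Λ, ∃ c : ℕ, c < b ∧ f x = (f y + c) / b) → ∀ x ∈ Λ, 0 ≤ f x ∧ f x ≤ 1 := by
    intro f hf b hb H
    have hb0 : (2:ℝ) ≤ b := by exact_mod_cast hb
    obtain ⟨u, hu, hu'⟩ := hΛ.1.exists_isMinOn hΛ.2.1 hf.continuousOn
    obtain ⟨v, hv, hv'⟩ := hΛ.1.exists_isMaxOn hΛ.2.1 hf.continuousOn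
    have h0 : 0 ≤ f u := by
      obtain ⟨y, hy, c, hc, h⟩ := H u hu
      have h1 : f u ≤ f y := hu' hy
      rw [eq_div_iff (by positivity)] at h
      have : (0:ℝ) ≤ c := by positivity
      nlinarith
    have h1 : f v ≤ 1 := by
      obtain ⟨y, hy, c, hc, h⟩ := H v hv
      have h1 : f y ≤ f v := hv' hy
      rw [eq_div_iff (by positivity)] at h
      have : (c:ℝ) + 1 ≤ b := by exact_mod_cast hc
      nlinarith
    intro x hx
    exact ⟨h0.trans (hu' hx), le_trans (hv' hx) h1⟩
  intro x hx
  constructor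
  · refine aux Prod.fst continuous_fst n (by omega) ?_ x hx
    intro x hx
    obtain ⟨d, hd, y, hy, rfl⟩ := bm_exists_pre hΛ hx
    exact ⟨y, hy, d.2, (hD d hd).2, rfl⟩
  · refine aux Prod.snd continuous_snd m (by omega) ?_ x hx
    intro x hx
    obtain ⟨d, hd, y, hy, rfl⟩ := bm_exists_pre hΛ hx
    exact ⟨y, hy, d.1, (hD d hd).1, rfl⟩

/-- Every point of `Λ` has a coding. -/
lemma bm_code (m n : ℕ) (hm : 2 ≤ m) (hmn : m < n)
    (D : Finset (ℕ × ℕ)) (hD : ∀ d ∈ D, d.1 < m ∧ d.2 < n)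
    (Λ : Set (ℝ × ℝ)) (hΛ : IsAttractor m n D Λ) (x : ℝ × ℝ) (hx : x ∈ Λ) :
    ∃ i : Word D, ∀ l : ℕ,
      (∃ y : ℝ, 0 ≤ y ∧ y ≤ 1 ∧ x.1 =
        ∑ r ∈ Finset.range l, ((i r).1.2 : ℝ) * (n : ℝ) ^ (-(r + 1 : ℤ)) + y * (n:ℝ) ^ (-(l:ℤ))) ∧
      (∃ y : ℝ, 0 ≤ y ∧ y ≤ 1 ∧ x.2 =
        ∑ r ∈ Finset.range l, ((i r).1.1 : ℝ) * (m : ℝ) ^ (-(r + 1 : ℤ)) +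
          y * (m:ℝ) ^ (-(l:ℤ))) := by
  have hm0 : (m:ℝ) ≠ 0 := by positivity
  have hn0 : (n:ℝ) ≠ 0 := by
    have : n ≠ 0 := by omega
    exact_mod_cast this
  have H : ∀ z : Λ, ∃ (d : Digit D) (y : Λ), z.1 = Tmap m n d.1 y.1 := by
    intro z
    obtain ⟨d, hd, y, hy, h⟩ := bm_exists_pre hΛ z.2
    exact ⟨⟨d, hd⟩, ⟨y, hy⟩, h⟩
  choose f g hfg using H
  let s : ℕ → Λ := fun k => g^[k] ⟨x, hx⟩
  have hs : ∀ k, s (k+1) = g (s k) := fun k => Function.iterate_succ_apply' g k _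
  have hs0 : (s 0).1 = x := rfl
  have hstep : ∀ k, (s k).1 = Tmap m n (f (s k)).1 (s (k+1)).1 := by
    intro k
    rw [hs]
    exact hfg (s k)
  refine ⟨fun k => f (s k), fun l => ⟨⟨(s l).1.1, ?_⟩, ⟨(s l).1.2, ?_⟩⟩⟩
  · have hu := bm_unit m n hm hmn D hD Λ hΛ _ (s l).2
    refine ⟨hu.1.1, hu.1.2, ?_⟩
    clear hu
    induction l with
    | zero => simp [hs0]
    | succ l ih =>
      rw [ih, Finset.sum_range_succ]
      have h1 : (s l).1.1 = ((s (l+1)).1.1 + (f (s l)).1.2) / n := congrArg Prod.fst (hstep l)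
      have h2 : (n:ℝ) ^ (-((l+1 : ℕ):ℤ)) = (n:ℝ) ^ (-(l:ℤ)) / n := by
        rw [Nat.cast_add, Nat.cast_one, neg_add, zpow_add₀ hn0]
        simp [div_eq_mul_inv]
      have h3 : (n:ℝ) ^ (-((l:ℤ)+1)) = (n:ℝ) ^ (-(l:ℤ)) / n := by
        exact_mod_cast h2
      rw [h2, h3, h1]
      ring
  · have hu := bm_unit m n hm hmn D hD Λ hΛ _ (s l).2
    refine ⟨hu.2.1, hu.2.2, ?_⟩
    clear hu
    induction l with
    | zero => simp [hs0]
    | succ l ih =>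
      rw [ih, Finset.sum_range_succ]
      have h1 : (s l).1.2 = ((s (l+1)).1.2 + (f (s l)).1.1) / m := congrArg Prod.snd (hstep l)
      have h2 : (m:ℝ) ^ (-((l+1 : ℕ):ℤ)) = (m:ℝ) ^ (-(l:ℤ)) / m := by
        rw [Nat.cast_add, Nat.cast_one, neg_add, zpow_add₀ hm0]
        simp [div_eq_mul_inv]
      have h3 : (m:ℝ) ^ (-((l:ℤ)+1)) = (m:ℝ) ^ (-(l:ℤ)) / m := by
        exact_mod_cast h2
      rw [h2, h3, h1]
      ring

/-- Balls centred in `Λ` have positive measure. -/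
lemma bm_pos (m n : ℕ) (hm : 2 ≤ m) (hmn : m < n)
    (D : Finset (ℕ × ℕ)) (hD : ∀ d ∈ D, d.1 < m ∧ d.2 < n)
    (p : ℕ × ℕ → ℝ) (hp : ∀ d ∈ D, 0 < p d) (hp1 : ∑ d ∈ D, p d = 1)
    (μ : Measure (ℝ × ℝ)) (hμ1 : IsProbabilityMeasure μ) (hμ : IsSelfAffine m n D p μ)
    (Λ : Set (ℝ × ℝ)) (hΛ : IsAttractor m n D Λ) (k : ℕ) :
    ∀ x ∈ Λ, 0 < μ (closedBall x (1 / (m:ℝ) ^ k)) := by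
  have hm0 : (0:ℝ) < m := by positivity
  induction k with
  | zero =>
    intro x hx
    have hfull := bm_full m n hm hmn D p hp hp1 μ hμ1 hμ Λ hΛ
    have h1 : μ Λ = 1 := (prob_compl_eq_zero_iff hΛ.1.isClosed.measurableSet).1 hfull
    have h2 : μ Λ ≤ μ (closedBall x (1 / (m:ℝ) ^ 0)) := by
      apply measure_mono
      intro y hy
      have hx' := bm_unit m n hm hmn D hD Λ hΛ x hx
      have hy' := bm_unit m n hm hmn D hD Λ hΛ y hy
      rw [mem_closedBall, Prod.dist_eq, Real.dist_eq, Real.dist_eq]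
      simp only [pow_zero, div_one]
      apply max_le <;> rw [abs_le] <;> constructor <;> linarith [hx'.1.1, hx'.1.2, hx'.2.1,
        hx'.2.2, hy'.1.1, hy'.1.2, hy'.2.1, hy'.2.2]
    rw [h1] at h2
    exact lt_of_lt_of_le one_pos h2
  | succ k ih =>
    intro x hx
    obtain ⟨d, hd, y, hy, rfl⟩ := bm_exists_pre hΛ hx
    rw [hμ _ isClosed_closedBall.measurableSet]
    have h1 : ENNReal.ofReal (p d) * μ (closedBall y (1 / (m:ℝ) ^ k)) ≤
        ∑ d' ∈ D, ENNReal.ofReal (p d') *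
          μ (Tmap m n d' ⁻¹' closedBall (Tmap m n d y) (1 / (m:ℝ) ^ (k+1))) := by
      refine le_trans ?_ (Finset.single_le_sum (f := fun d' => ENNReal.ofReal (p d') *
          μ (Tmap m n d' ⁻¹' closedBall (Tmap m n d y) (1 / (m:ℝ) ^ (k+1))))
          (fun _ _ => zero_le) hd)
      gcongr
      intro z hz
      rw [mem_closedBall] at hz
      rw [mem_preimage, mem_closedBall]
      refine (bm_dist_Tmap m n hm hmn d z y).trans ?_
      rw [pow_succ, ← div_div]
      gcongr
    refine lt_of_lt_of_le ?_ h1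
    exact ENNReal.mul_pos (by simpa using hp d hd) (ih y hy).ne'


lemma bm_q (D : Finset (ℕ × ℕ)) (hrow : ∃ d ∈ D, ∃ d' ∈ D, d.1 ≠ d'.1)
    (p : ℕ × ℕ → ℝ) (hp : ∀ d ∈ D, 0 < p d) (hp1 : ∑ d ∈ D, p d = 1) :
    ∃ q : ℝ, 0 < q ∧ q < 1 ∧ ∀ i, qrow D p i ≤ q := by
  obtain ⟨d, hd, d', hd', hne⟩ := hrow
  obtain ⟨e, he, hmin⟩ := D.exists_min_image p ⟨d, hd⟩
  have key : ∀ i, qrow D p i ≤ 1 - p e := by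
    intro i
    have : ∃ f ∈ D, f.1 ≠ i := by
      by_cases h : d.1 = i
      · exact ⟨d', hd', fun h' => hne (h.trans h'.symm)⟩
      · exact ⟨d, hd, h⟩
    obtain ⟨f, hf, hfi⟩ := this
    have h1 : qrow D p i + ∑ x ∈ D.filter (fun x => ¬ x.1 = i), p x = 1 := by
      rw [← hp1]
      exact Finset.sum_filter_add_sum_filter_not D _ p
    have h2 : p f ≤ ∑ x ∈ D.filter (fun x => ¬ x.1 = i), p x := by
      apply Finset.single_le_sum (f := p)
      · intro x hx
        exact (hp x (Finset.mem_filter.1 hx).1).le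
      · exact Finset.mem_filter.2 ⟨hf, hfi⟩
    have := hmin f hf
    linarith
  refine ⟨max (1 - p e) (1/2), ?_, ?_, fun i => (key i).trans (le_max_left _ _)⟩
  · exact lt_of_lt_of_le (by norm_num) (le_max_right _ _)
  · apply max_lt
    · linarith [hp e he]
    · norm_num

lemma bm_sum_row (D : Finset (ℕ × ℕ)) (p : ℕ × ℕ → ℝ) (hp : ∀ d ∈ D, 0 < p d) (q : ℝ)
    (i0 : ℕ) (hq : qrow D p i0 ≤ q) (c : ℕ × ℕ → ℝ≥0∞) (B : ℝ≥0∞)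
    (h1 : ∀ d ∈ D, d.1 = i0 → c d ≤ B) (h0 : ∀ d ∈ D, d.1 ≠ i0 → c d = 0) :
    ∑ d ∈ D, ENNReal.ofReal (p d) * c d ≤ ENNReal.ofReal q * B := by
  rw [← Finset.sum_filter_add_sum_filter_not D (fun d => d.1 = i0)]
  have h2 : ∑ d ∈ D.filter (fun d => ¬ d.1 = i0), ENNReal.ofReal (p d) * c d = 0 := by
    apply Finset.sum_eq_zero
    intro d hd
    rw [Finset.mem_filter] at hd
    rw [h0 d hd.1 hd.2, mul_zero]
  rw [h2, add_zero]
  calc _ ≤ ∑ d ∈ D.filter (fun d => d.1 = i0), ENNReal.ofReal (p d) * B := by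
        apply Finset.sum_le_sum
        intro d hd
        rw [Finset.mem_filter] at hd
        gcongr
        exact h1 d hd.1 hd.2
    _ = ENNReal.ofReal (qrow D p i0) * B := by
        rw [← Finset.sum_mul, qrow, ENNReal.ofReal_sum_of_nonneg]
        intro d hd
        exact (hp d (Finset.mem_filter.1 hd).1).le
    _ ≤ _ := by gcongr

lemma bm_null (m n : ℕ) (hm : 2 ≤ m) (hmn : m < n)
    (D : Finset (ℕ × ℕ)) (hD : ∀ d ∈ D, d.1 < m ∧ d.2 < n)
    (μ : Measure (ℝ × ℝ))
    (Λ : Set (ℝ × ℝ)) (hΛ : IsAttractor m n D Λ) (hfull : μ Λᶜ = 0) (A : Set (ℝ × ℝ))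
    (hA : ∀ z ∈ A, z.2 < 0 ∨ 1 < z.2) : μ A = 0 := by
  apply measure_mono_null _ hfull
  intro z hz hzΛ
  have := (bm_unit m n hm hmn D hD Λ hΛ z hzΛ).2
  rcases hA z hz with h | h <;> linarith [this.1, this.2]

lemma bm_line (m n : ℕ) (hm : 2 ≤ m) (hmn : m < n)
    (D : Finset (ℕ × ℕ)) (hD : ∀ d ∈ D, d.1 < m ∧ d.2 < n)
    (p : ℕ × ℕ → ℝ) (hp : ∀ d ∈ D, 0 < p d)
    (μ : Measure (ℝ × ℝ)) (hμ1 : IsProbabilityMeasure μ) (hμ : IsSelfAffine m n D p μ)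
    (Λ : Set (ℝ × ℝ)) (hΛ : IsAttractor m n D Λ) (hfull : μ Λᶜ = 0)
    (q : ℝ) (hq1 : q < 1) (hq : ∀ i, qrow D p i ≤ q) :
    μ {z : ℝ × ℝ | z.2 = 1} = 0 := by
  have hm0 : (0:ℝ) < m := by positivity
  have hmeas : MeasurableSet {z : ℝ × ℝ | z.2 = 1} :=
    (isClosed_eq continuous_snd continuous_const).measurableSet
  have h := hμ _ hmeas
  have h2 := bm_sum_row D p hp q (m-1) (hq _)
    (fun d => μ (Tmap m n d ⁻¹' {z : ℝ × ℝ | z.2 = 1})) (μ {z : ℝ × ℝ | z.2 = 1}) ?_ ?_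
  · rw [← h] at h2
    by_contra hne
    have : ENNReal.ofReal q * μ {z : ℝ × ℝ | z.2 = 1} < 1 * μ {z : ℝ × ℝ | z.2 = 1} := by
      apply ENNReal.mul_lt_mul_left hne (measure_ne_top _ _)
      rw [ENNReal.ofReal_lt_one]
      exact hq1
    rw [one_mul] at this
    exact absurd h2 (not_le.2 this)
  · intro d hd hdm
    apply measure_mono
    intro z hz
    simp only [Tmap, mem_preimage, mem_ofPred_eq] at hz ⊢
    rw [div_eq_iff hm0.ne', hdm, Nat.cast_sub (by omega)] at hz
    push_cast at hz
    linarith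
  · intro d hd hdm
    apply bm_null m n hm hmn D hD μ Λ hΛ hfull
    intro z hz
    right
    simp only [Tmap, mem_preimage, mem_ofPred_eq] at hz
    rw [div_eq_iff hm0.ne'] at hz
    have h3 : d.1 + 2 ≤ m := by have := (hD d hd).1; omega
    have h4 : (d.1:ℝ) + 2 ≤ m := by exact_mod_cast h3
    linarith

lemma bm_strip (m n : ℕ) (hm : 2 ≤ m) (hmn : m < n)
    (D : Finset (ℕ × ℕ)) (hD : ∀ d ∈ D, d.1 < m ∧ d.2 < n)
    (p : ℕ × ℕ → ℝ) (hp : ∀ d ∈ D, 0 < p d)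
    (μ : Measure (ℝ × ℝ)) (hμ1 : IsProbabilityMeasure μ) (hμ : IsSelfAffine m n D p μ)
    (Λ : Set (ℝ × ℝ)) (hΛ : IsAttractor m n D Λ) (hfull : μ Λᶜ = 0)
    (q : ℝ) (hq1 : q < 1) (hq : ∀ i, qrow D p i ≤ q) (k : ℕ) :
    ∀ b : ℤ, μ {z : ℝ × ℝ | (b:ℝ) ≤ z.2 * (m:ℝ) ^ k ∧ z.2 * (m:ℝ) ^ k < b + 1} ≤
      ENNReal.ofReal q ^ k := by
  have hm0 : (0:ℝ) < m := by positivity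
  have hline := bm_line m n hm hmn D hD p hp μ hμ1 hμ Λ hΛ hfull q hq1 hq
  induction k with
  | zero => intro b; simpa using prob_le_one
  | succ k ih =>
    intro b
    have hmeas : MeasurableSet
        {z : ℝ × ℝ | (b:ℝ) ≤ z.2 * (m:ℝ) ^ (k+1) ∧ z.2 * (m:ℝ) ^ (k+1) < b + 1} := by
      have hf : Measurable (fun z : ℝ × ℝ => z.2 * (m:ℝ) ^ (k+1)) := by fun_prop
      exact (measurableSet_le measurable_const hf).inter (measurableSet_lt hf measurable_const)
    rw [hμ _ hmeas, pow_succ' (ENNReal.ofReal q)]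
    have hpre : ∀ d : ℕ × ℕ, Tmap m n d ⁻¹'
        {z : ℝ × ℝ | (b:ℝ) ≤ z.2 * (m:ℝ) ^ (k+1) ∧ z.2 * (m:ℝ) ^ (k+1) < b + 1} =
        {z : ℝ × ℝ | ((b - d.1 * (m:ℤ)^k : ℤ):ℝ) ≤ z.2 * (m:ℝ) ^ k ∧
          z.2 * (m:ℝ) ^ k < ((b - d.1 * (m:ℤ)^k : ℤ):ℝ) + 1} := by
      intro d
      ext z
      simp only [Tmap, mem_preimage, mem_ofPred_eq]
      have : (z.2 + d.1) / (m:ℝ) * (m:ℝ) ^ (k+1) = z.2 * (m:ℝ)^k + d.1 * (m:ℝ)^k := by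
        rw [pow_succ]
        field_simp
      rw [this]
      push_cast
      constructor <;> rintro ⟨h1, h2⟩ <;> constructor <;> linarith
    have hmk : (0:ℤ) < (m:ℤ)^k := by positivity
    have hmk' : (0:ℝ) < (m:ℝ)^k := by positivity
    apply bm_sum_row D p hp q (b / (m:ℤ)^k).toNat (hq _)
    · intro d _ _
      rw [hpre]
      exact ih _
    · intro d _ hd
      rw [hpre]
      have hcase : b - d.1 * (m:ℤ)^k ≤ -1 ∨ (m:ℤ)^k ≤ b - d.1 * (m:ℤ)^k := by
        by_contra hcon
        push Not at hcon
        apply hd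
        have h0 : b / (m:ℤ)^k = d.1 := by
          refine ((Int.ediv_emod_unique (r := b - d.1 * (m:ℤ)^k) hmk).2 ⟨by ring, ?_, hcon.2⟩).1
          linarith [hcon.1]
        rw [h0]
        simp
      rcases hcase with h | h
      · apply bm_null m n hm hmn D hD μ Λ hΛ hfull
        rintro z ⟨_, hz⟩
        left
        have h' : ((b - d.1 * (m:ℤ)^k : ℤ):ℝ) ≤ -1 := by exact_mod_cast h
        by_contra hz0
        push Not at hz0
        have : 0 ≤ z.2 * (m:ℝ)^k := by positivity
        linarith
      · have h' : (m:ℝ)^k ≤ ((b - d.1 * (m:ℤ)^k : ℤ):ℝ) := by exact_mod_cast h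
        have hsub : {z : ℝ × ℝ | ((b - d.1 * (m:ℤ)^k : ℤ):ℝ) ≤ z.2 * (m:ℝ) ^ k ∧
          z.2 * (m:ℝ) ^ k < ((b - d.1 * (m:ℤ)^k : ℤ):ℝ) + 1} ⊆
            {z : ℝ × ℝ | z.2 = 1} ∪ {z : ℝ × ℝ | 1 < z.2} := by
          rintro z ⟨hz, _⟩
          have : 1 ≤ z.2 := by
            by_contra hlt
            push Not at hlt
            nlinarith
          rcases this.eq_or_lt with h | h
          · left; exact h.symm
          · right; exact h
        apply measure_mono_null hsub
        rw [measure_union_null_iff]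
        refine ⟨hline, ?_⟩
        apply bm_null m n hm hmn D hD μ Λ hΛ hfull
        intro z hz
        right
        exact hz

lemma bm_upper (m n : ℕ) (hm : 2 ≤ m) (hmn : m < n)
    (D : Finset (ℕ × ℕ)) (hD : ∀ d ∈ D, d.1 < m ∧ d.2 < n)
    (p : ℕ × ℕ → ℝ) (hp : ∀ d ∈ D, 0 < p d)
    (μ : Measure (ℝ × ℝ)) (hμ1 : IsProbabilityMeasure μ) (hμ : IsSelfAffine m n D p μ)
    (Λ : Set (ℝ × ℝ)) (hΛ : IsAttractor m n D Λ) (hfull : μ Λᶜ = 0)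
    (q : ℝ) (hq1 : q < 1) (hq : ∀ i, qrow D p i ≤ q) (k : ℕ) (x : ℝ × ℝ) :
    μ (ball x (1 / (m:ℝ)^k)) ≤ 3 * ENNReal.ofReal q ^ k := by
  have hmk' : (0:ℝ) < (m:ℝ)^k := by positivity
  have hs := bm_strip m n hm hmn D hD p hp μ hμ1 hμ Λ hΛ hfull q hq1 hq k
  let S : ℤ → Set (ℝ × ℝ) := fun b =>
    {z : ℝ × ℝ | (b:ℝ) ≤ z.2 * (m:ℝ) ^ k ∧ z.2 * (m:ℝ) ^ k < b + 1}
  have hS : ∀ b, μ (S b) ≤ ENNReal.ofReal q ^ k := hs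
  let b := ⌊x.2 * (m:ℝ)^k⌋
  have hb1 : (b:ℝ) ≤ x.2 * (m:ℝ)^k := Int.floor_le _
  have hb2 : x.2 * (m:ℝ)^k < b + 1 := Int.lt_floor_add_one _
  have hsub : ball x (1 / (m:ℝ)^k) ⊆ S (b-1) ∪ S b ∪ S (b+1) := by
    intro z hz
    rw [mem_ball, Prod.dist_eq, max_lt_iff, Real.dist_eq, Real.dist_eq] at hz
    have h1 := hz.2
    rw [abs_lt] at h1
    have e1 : 1 / (m:ℝ)^k * (m:ℝ)^k = 1 := by field_simp
    have h2 : z.2 * (m:ℝ)^k < x.2 * (m:ℝ)^k + 1 := by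
      have := mul_lt_mul_of_pos_right h1.2 hmk'
      linarith
    have h3 : x.2 * (m:ℝ)^k - 1 < z.2 * (m:ℝ)^k := by
      have := mul_lt_mul_of_pos_right h1.1 hmk'
      linarith
    by_cases c1 : z.2 * (m:ℝ)^k < b
    · left; left
      simp only [S, mem_ofPred_eq]
      push_cast
      constructor <;> linarith
    · by_cases c2 : z.2 * (m:ℝ)^k < b + 1
      · left; right
        exact ⟨not_lt.1 c1, c2⟩
      · right
        simp only [S, mem_ofPred_eq]
        push_cast
        constructor <;> linarith
  calc _ ≤ μ (S (b-1) ∪ S b ∪ S (b+1)) := measure_mono hsub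
    _ ≤ μ (S (b-1)) + μ (S b) + μ (S (b+1)) :=
        (measure_union_le _ _).trans (by gcongr; exact measure_union_le _ _)
    _ ≤ ENNReal.ofReal q ^ k + ENNReal.ofReal q ^ k + ENNReal.ofReal q ^ k := by
        gcongr <;> apply hS
    _ = _ := by ring

lemma bm_alpha_pos (m n : ℕ) (hm : 2 ≤ m) (hmn : m < n)
    (D : Finset (ℕ × ℕ)) (hD : ∀ d ∈ D, d.1 < m ∧ d.2 < n)
    (hrow : ∃ d ∈ D, ∃ d' ∈ D, d.1 ≠ d'.1)
    (p : ℕ × ℕ → ℝ) (hp : ∀ d ∈ D, 0 < p d) (hp1 : ∑ d ∈ D, p d = 1)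
    (μ : Measure (ℝ × ℝ)) (hμ1 : IsProbabilityMeasure μ) (hμ : IsSelfAffine m n D p μ)
    (Λ : Set (ℝ × ℝ)) (hΛ : IsAttractor m n D Λ) (x : ℝ × ℝ) (hx : x ∈ Λ) (α : ℝ)
    (hα : HasLocalDim μ x α) : 0 < α := by
  have hm0 : (0:ℝ) < m := by positivity
  have hm1 : (1:ℝ) < m := by exact_mod_cast (by omega : 1 < m)
  have hlogm : 0 < Real.log m := Real.log_pos hm1
  have hfull := bm_full m n hm hmn D p hp hp1 μ hμ1 hμ Λ hΛ
  obtain ⟨q, hq0, hq1, hq⟩ := bm_q D hrow p hp hp1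
  have hlogq : Real.log q < 0 := Real.log_neg hq0 hq1
  have hr : Tendsto (fun k : ℕ => 1 / (m:ℝ)^k) atTop (𝓝[>] 0) := by
    rw [tendsto_nhdsWithin_iff]
    constructor
    · have := tendsto_pow_atTop_nhds_zero_of_lt_one (r := (m:ℝ)⁻¹) (by positivity)
        (inv_lt_one_of_one_lt₀ hm1)
      simpa using this
    · exact Eventually.of_forall fun k => by simp only [mem_Ioi]; positivity
  have h1 : Tendsto _ atTop (𝓝 α) := hα.comp hr
  have h2 : Tendsto (fun k : ℕ => (-Real.log q) / Real.log m - (Real.log 3 / Real.log m) / (k:ℝ))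
      atTop (𝓝 ((-Real.log q) / Real.log m - 0)) := by
    apply Tendsto.sub tendsto_const_nhds
    exact tendsto_const_div_atTop_nhds_zero_nat _
  have h3 : (-Real.log q) / Real.log m - 0 ≤ α := by
    apply le_of_tendsto_of_tendsto h2 h1
    filter_upwards [eventually_gt_atTop 0] with k hk
    have hk' : (0:ℝ) < k := by exact_mod_cast hk
    simp only [Function.comp]
    have hpos : 0 < μ (ball x (1 / (m:ℝ)^k)) := by
      refine lt_of_lt_of_le
        (bm_pos m n hm hmn D hD p hp hp1 μ hμ1 hμ Λ hΛ (k+1) x hx) (measure_mono ?_)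
      apply closedBall_subset_ball
      apply one_div_lt_one_div_of_lt (by positivity)
      exact pow_lt_pow_right₀ hm1 (by omega)
    have hup := bm_upper m n hm hmn D hD p hp μ hμ1 hμ Λ hΛ hfull q hq1 hq k x
    have hposr : 0 < (μ (ball x (1 / (m:ℝ)^k))).toReal :=
      ENNReal.toReal_pos hpos.ne' (measure_ne_top _ _)
    have hupr : (μ (ball x (1 / (m:ℝ)^k))).toReal ≤ 3 * q ^ k := by
      apply ENNReal.toReal_le_of_le_ofReal (by positivity)
      rw [ENNReal.ofReal_mul (by norm_num), ENNReal.ofReal_pow hq0.le]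
      simpa using hup
    have hl := Real.log_le_log hposr hupr
    rw [Real.log_mul (by norm_num) (by positivity), Real.log_pow] at hl
    rw [one_div, Real.log_inv, Real.log_pow, div_neg, ← neg_div, le_div_iff₀ (by positivity)]
    have : (-Real.log q / Real.log m - Real.log 3 / Real.log m / k) * (k * Real.log m) =
        - Real.log q * k - Real.log 3 := by
      field_simp
    rw [this]
    rw [one_div] at hl
    linarith
  have h4 : 0 < (-Real.log q) / Real.log m := div_pos (by linarith) hlogm
  linarith


/-- The integer with base-`b` digits `r 0, …, r (k-1)`. -/
def bmN (b : ℕ) (r : ℕ → ℕ) : ℕ → ℤ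
  | 0 => 0
  | k + 1 => b * bmN b r k + r k

lemma bm_sum_eq (b : ℕ) (hb : 2 ≤ b) (r : ℕ → ℕ) (k : ℕ) :
    ∑ q ∈ Finset.range k, (r q : ℝ) * (b : ℝ) ^ (-(q + 1 : ℤ)) =
      bmN b r k * (b : ℝ) ^ (-(k:ℤ)) := by
  have hb0 : (b:ℝ) ≠ 0 := by positivity
  induction k with
  | zero => simp [bmN]
  | succ k ih =>
    have h3 : (b:ℝ) ^ (-((k:ℤ)+1)) = (b:ℝ) ^ (-(k:ℤ)) / b := by
      rw [neg_add, zpow_add₀ hb0]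
      simp [div_eq_mul_inv]
    rw [Finset.sum_range_succ, ih]
    push_cast
    rw [h3, bmN]
    push_cast
    field_simp

lemma bm_digit {b : ℕ} {u v : ℤ} {x y : ℕ} (hx : x < b) (hy : y < b)
    (h : (b:ℤ) * u + x = b * v + y) : u = v ∧ x = y := by
  have h1 : u = v := by
    have hx' : (x:ℤ) < b := by exact_mod_cast hx
    have hy' : (y:ℤ) < b := by exact_mod_cast hy
    have hx0 : (0:ℤ) ≤ x := by positivity
    have hy0 : (0:ℤ) ≤ y := by positivity
    rcases lt_trichotomy u v with h' | h' | h'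
    · nlinarith
    · exact h'
    · nlinarith
  subst h1
  refine ⟨rfl, ?_⟩
  have : (x:ℤ) = y := by linarith
  exact_mod_cast this

lemma bm_digits {b : ℕ} {r r' : ℕ → ℕ} (hr : ∀ q, r q < b) (hr' : ∀ q, r' q < b) (k : ℕ)
    (h : bmN b r' k = bmN b r k) : ∀ q < k, r' q = r q := by
  induction k with
  | zero => intro q hq; omega
  | succ k ih =>
    simp only [bmN] at h
    obtain ⟨h1, h2⟩ := bm_digit (hr' k) (hr k) h
    intro q hq
    rcases Nat.lt_succ_iff_lt_or_eq.1 hq with h | h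
    · exact ih h1 q h
    · rw [h]; exact h2

/-- `bmCode b r x`: the digits `r` code the real number `x` in base `b`. -/
def bmCode (b : ℕ) (r : ℕ → ℕ) (x : ℝ) : Prop :=
  ∀ l : ℕ, ∃ y : ℝ, 0 ≤ y ∧ y ≤ 1 ∧ x * (b:ℝ) ^ l = bmN b r l + y

lemma bm_near {b : ℕ} (hb : 2 ≤ b) {r r' : ℕ → ℕ} (hr : ∀ q, r q < b) {x z : ℝ}
    (hx : bmCode b r x) (hz : bmCode b r' z) (k : ℕ) (h : |z - x| * (b:ℝ) ^ (k+1) < 1) :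
    bmN b r' k = bmN b r k ∨ (bmN b r' k = bmN b r k + 1 ∧ r k = b - 1) ∨
      (bmN b r' k = bmN b r k - 1 ∧ r k = 0) := by
  have hb0 : (0:ℝ) < b := by positivity
  obtain ⟨y, hy0, hy1, hy⟩ := hx (k+1)
  obtain ⟨y', hy0', hy1', hy'⟩ := hz k
  have hz2 : z * (b:ℝ)^(k+1) = b * (bmN b r' k + y') := by
    rw [← hy', pow_succ]; ring
  rw [bmN] at hy
  push_cast at hy
  have hbk : (0:ℝ) < (b:ℝ)^(k+1) := by positivity
  rw [← abs_of_pos hbk, ← abs_mul, abs_lt, sub_mul] at h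
  have h1 : (b:ℝ) * bmN b r' k < b * bmN b r k + r k + 2 := by nlinarith
  have h2 : (b:ℝ) * bmN b r k + r k - 1 < b * bmN b r' k + b := by nlinarith
  have h1' : (b:ℤ) * bmN b r' k < b * bmN b r k + r k + 2 := by exact_mod_cast h1
  have h2' : (b:ℤ) * bmN b r k + r k - 1 < b * bmN b r' k + b := by exact_mod_cast h2
  have hbz : (2:ℤ) ≤ b := by exact_mod_cast hb
  have hrk : (r k:ℤ) < b := by exact_mod_cast hr k
  have hrk0 : (0:ℤ) ≤ r k := by positivity
  have hle : bmN b r' k ≤ bmN b r k + 1 := by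
    by_contra hcon
    push Not at hcon
    have : bmN b r k + 2 ≤ bmN b r' k := by omega
    nlinarith
  have hge : bmN b r k - 1 ≤ bmN b r' k := by
    by_contra hcon
    push Not at hcon
    have : bmN b r' k ≤ bmN b r k - 2 := by linarith
    nlinarith
  have htri : bmN b r' k = bmN b r k ∨ bmN b r' k = bmN b r k + 1 ∨
      bmN b r' k = bmN b r k - 1 := by omega
  rcases htri with h | h | h
  · exact Or.inl h
  · right; left
    refine ⟨h, ?_⟩
    rw [h] at h1'
    have : (b:ℤ) < r k + 2 := by linarith
    omega
  · right; right
    refine ⟨h, ?_⟩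
    rw [h] at h2'
    have : (r k : ℤ) - 1 < 0 := by linarith
    omega

/-- At a break level the digits of a nearby point agree except possibly the last one. -/
lemma bm_break_agree {b : ℕ} (hb : 2 ≤ b) {r r' : ℕ → ℕ} (hr : ∀ q, r q < b)
    (hr' : ∀ q, r' q < b) {x z : ℝ}
    (hx : bmCode b r x) (hz : bmCode b r' z) (k : ℕ)
    (h : |z - x| * (b:ℝ) ^ (k+1+1) < 1)
    (hbr : ¬ (r (k+1) = r k ∧ (r (k+1) = 0 ∨ r (k+1) = b - 1))) :
    ∀ q < k, r' q = r q := by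
  rcases bm_near hb hr hx hz (k+1) h with h | ⟨h, hk⟩ | ⟨h, hk⟩
  · intro q hq
    exact bm_digits hr hr' _ h q (by omega)
  · simp only [bmN] at h
    have hne : r k ≠ b - 1 := by
      intro hc
      exact hbr ⟨hk.trans hc.symm, Or.inr hk⟩
    have hlt : r k + 1 < b := by have := hr k; omega
    have := (bm_digit (v := bmN b r k) (hr' k) hlt (by push_cast; rw [h]; ring)).1
    exact bm_digits hr hr' _ this
  · simp only [bmN] at h
    have hne : r k ≠ 0 := by
      intro hc
      exact hbr ⟨hk.trans hc.symm, Or.inl hk⟩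
    have hlt : r k - 1 < b := by have := hr k; omega
    have hcast : ((r k - 1 : ℕ) : ℤ) = r k - 1 := by
      rw [Nat.cast_sub (by omega)]; simp
    have := (bm_digit (v := bmN b r k) (hr' k) hlt (by rw [hcast, h]; ring)).1
    exact bm_digits hr hr' _ this

/-- If the digits of `x` are eventually constantly `0` or `b-1`, digits of a nearby point are
constant on `[s,k)`. -/
lemma bm_const_agree {b : ℕ} (hb : 2 ≤ b) {r r' : ℕ → ℕ} (hr : ∀ q, r q < b)
    (hr' : ∀ q, r' q < b) {x z : ℝ}
    (hx : bmCode b r x) (hz : bmCode b r' z) (s : ℕ) (hs : ∀ q, s ≤ q → r q = r s)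
    (k : ℕ) (h : |z - x| * (b:ℝ) ^ (k+1) < 1) :
    ∃ c < b, ∀ q, s ≤ q → q < k → r' q = c := by
  rcases bm_near hb hr hx hz k h with h | ⟨h, hk⟩ | ⟨h, hk⟩
  · exact ⟨r s, hr s, fun q hq hqk => by rw [bm_digits hr hr' _ h q hqk, hs q hq]⟩
  · refine ⟨0, by omega, ?_⟩
    by_cases hsk' : k ≤ s
    · intro q hq hqk; omega
    have hrs : r s = b - 1 := by rw [← hs k (by omega), hk]
    clear hk hsk'
    induction k with
    | zero => intro q hq hqk; omega
    | succ k ih =>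
      intro q hq hqk
      have hrk : r k = b - 1 := by rw [hs k (by omega), hrs]
      simp only [bmN, hrk] at h
      have hcast : ((b - 1 : ℕ) : ℤ) = b - 1 := by
        rw [Nat.cast_sub (by omega)]; simp
      have := bm_digit (v := bmN b r k + 1) (hr' k) (show 0 < b by omega)
        (by rw [h, hcast]; push_cast; ring)
      rcases Nat.lt_succ_iff_lt_or_eq.1 hqk with h' | h'
      · refine ih ?_ this.1 q hq h'
        refine lt_of_le_of_lt ?_ ‹|z - x| * (b:ℝ) ^ (k+1+1) < 1›
        gcongr
        · exact_mod_cast (by omega : 1 ≤ b)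
        · omega
      · rw [h']; exact this.2
  · refine ⟨b - 1, by omega, ?_⟩
    by_cases hsk' : k ≤ s
    · intro q hq hqk; omega
    have hrs : r s = 0 := by rw [← hs k (by omega), hk]
    clear hk hsk'
    induction k with
    | zero => intro q hq hqk; omega
    | succ k ih =>
      intro q hq hqk
      have hrk : r k = 0 := by rw [hs k (by omega), hrs]
      simp only [bmN, hrk] at h
      have hcast : ((b - 1 : ℕ) : ℤ) = b - 1 := by
        rw [Nat.cast_sub (by omega)]; simp
      have := bm_digit (v := bmN b r k - 1) (hr' k) (show b - 1 < b by omega)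
        (by rw [h, hcast]; push_cast; ring)
      rcases Nat.lt_succ_iff_lt_or_eq.1 hqk with h' | h'
      · refine ih ?_ this.1 q hq h'
        refine lt_of_le_of_lt ?_ ‹|z - x| * (b:ℝ) ^ (k+1+1) < 1›
        gcongr
        · exact_mod_cast (by omega : 1 ≤ b)
        · omega
      · rw [h']; exact this.2

/-- Averages of `w` along `r`. -/
def bmB (w : ℕ → ℝ) (r : ℕ → ℕ) (l : ℕ) : ℝ :=
  (1 / (l : ℝ)) * ∑ q ∈ Finset.range l, w (r q)

lemma bm_B_congr {w : ℕ → ℝ} {r r' : ℕ → ℕ} {l : ℕ} (h : ∀ q < l, r' q = r q) :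
    bmB w r' l = bmB w r l := by
  unfold bmB
  congr 1
  apply Finset.sum_congr rfl
  intro q hq
  rw [h q (Finset.mem_range.1 hq)]

lemma bm_B_last {w : ℕ → ℝ} {r r' : ℕ → ℕ} {C : ℝ} (hr : ∀ q, |w (r q)| ≤ C)
    (hr' : ∀ q, |w (r' q)| ≤ C) {k : ℕ} (h : ∀ q < k, r' q = r q) :
    |bmB w r' (k+1) - bmB w r (k+1)| ≤ 2 * C / ((k+1 : ℕ):ℝ) := by
  unfold bmB
  rw [Finset.sum_range_succ, Finset.sum_range_succ]
  have : ∑ q ∈ Finset.range k, w (r' q) = ∑ q ∈ Finset.range k, w (r q) := by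
    apply Finset.sum_congr rfl
    intro q hq
    rw [h q (Finset.mem_range.1 hq)]
  rw [this]
  have e : 1 / ((k+1 : ℕ):ℝ) * (∑ q ∈ Finset.range k, w (r q) + w (r' k)) -
      1 / ((k+1 : ℕ):ℝ) * (∑ q ∈ Finset.range k, w (r q) + w (r k)) =
      (w (r' k) - w (r k)) / ((k+1 : ℕ):ℝ) := by ring
  rw [e, abs_div, Nat.abs_cast]
  gcongr
  calc _ ≤ |w (r' k)| + |w (r k)| := abs_sub _ _
    _ ≤ 2 * C := by linarith [hr k, hr' k]

lemma bm_B_const {w : ℕ → ℝ} {r : ℕ → ℕ} {C : ℝ} (hr : ∀ q, |w (r q)| ≤ C) {c : ℕ}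
    (hc : |w c| ≤ C) {s l : ℕ} (hl : 1 ≤ l) (h : ∀ q, s ≤ q → q < l → r q = c) :
    |bmB w r l - w c| ≤ 2 * s * C / (l:ℝ) := by
  have hl0 : (0:ℝ) < l := by exact_mod_cast hl
  have hC : 0 ≤ C := (abs_nonneg _).trans hc
  have e : bmB w r l - w c = (∑ q ∈ Finset.range l, (w (r q) - w c)) / l := by
    unfold bmB
    rw [Finset.sum_sub_distrib, Finset.sum_const, Finset.card_range, nsmul_eq_mul]
    field_simp
  rw [e, abs_div, Nat.abs_cast]
  gcongr
  calc |∑ q ∈ Finset.range l, (w (r q) - w c)|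
      ≤ ∑ q ∈ Finset.range l, |w (r q) - w c| := Finset.abs_sum_le_sum_abs _ _
    _ ≤ ∑ q ∈ Finset.range l, (if q < s then 2 * C else 0) := by
        apply Finset.sum_le_sum
        intro q hq
        split_ifs with hqs
        · calc _ ≤ |w (r q)| + |w c| := abs_sub _ _
            _ ≤ 2 * C := by linarith [hr q]
        · rw [h q (not_lt.1 hqs) (Finset.mem_range.1 hq)]; simp
    _ = ((Finset.range l).filter (fun q => q < s)).card * (2 * C) := by
        rw [← Finset.sum_filter, Finset.sum_const, nsmul_eq_mul]
    _ ≤ s * (2 * C) := by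
        gcongr
        have : (Finset.range l).filter (fun q => q < s) ⊆ Finset.range s := by
          intro q hq
          rw [Finset.mem_filter] at hq
          exact Finset.mem_range.2 hq.2
        simpa using Finset.card_le_card this
    _ = 2 * s * C := by ring

/-- There are arbitrarily large break levels with `A_k ≥ -δ`. -/
lemma bm_break {b : ℕ} {w : ℕ → ℝ} {r : ℕ → ℕ} {C : ℝ} (hr : ∀ q, |w (r q)| ≤ C)
    {l : ℕ → ℕ} (hl : Tendsto l atTop atTop) {δ : ℝ} (hδ : 0 < δ)
    (hne : ¬ ∃ s, (r s = 0 ∨ r s = b - 1) ∧ ∀ q, s ≤ q → r q = r s) (K : ℕ) :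
    ∃ k, K < k + 1 ∧ ¬ (r (k+1) = r k ∧ (r (k+1) = 0 ∨ r (k+1) = b - 1)) ∧
      -δ ≤ bmB w r (l (k+1)) - bmB w r (k+1) := by
  by_contra hcon
  push Not at hcon
  set S : ℕ → ℝ := fun k => ∑ q ∈ Finset.range k, w (r q) with hS
  have hSs : ∀ k, S (k+1) = S k + w (r k) := fun k => Finset.sum_range_succ _ _
  have hSB : ∀ k, 1 ≤ k → bmB w r k * k = S k := by
    intro k hk
    have : (0:ℝ) < k := by exact_mod_cast hk
    simp only [bmB, hS]
    field_simp
  have hSabs : ∀ k, |S k| ≤ k * C := by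
    intro k
    calc |S k| ≤ ∑ q ∈ Finset.range k, |w (r q)| := Finset.abs_sum_le_sum_abs _ _
      _ ≤ ∑ q ∈ Finset.range k, C := Finset.sum_le_sum fun q _ => hr q
      _ = k * C := by simp
  have claim : ∀ a : ℕ, ∃ Ka, 1 ≤ Ka ∧ ∀ k, Ka ≤ k → k * (-C + a * δ) ≤ S k := by
    intro a
    induction a with
    | zero =>
      refine ⟨1, le_rfl, fun k _ => ?_⟩
      have := (abs_le.1 (hSabs k)).1
      push_cast
      linarith
    | succ a ih =>
      obtain ⟨Ka, hKa1, hKa⟩ := ih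
      obtain ⟨K0, hK0⟩ := eventually_atTop.1 (hl.eventually_ge_atTop Ka)
      set β : ℝ := -C + ((a+1 : ℕ):ℝ) * δ with hβ
      have good : ∀ k, max K0 K ≤ k →
          ¬ (r (k+1) = r k ∧ (r (k+1) = 0 ∨ r (k+1) = b - 1)) →
          ((k+1 : ℕ):ℝ) * β ≤ S (k+1) := by
        intro k hk hbr
        have h1 := hcon k (by have := le_max_right K0 K; omega)
          (fun h => by
            by_contra hx
            push Not at hx
            apply hbr
            refine ⟨h, ?_⟩
            by_contra hy
            push Not at hy
            exact absurd hy.2 (by intro h'; exact h' (hx hy.1)))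
        have hlk : Ka ≤ l (k+1) := hK0 _ (by have := le_max_left K0 K; omega)
        have h2 := hKa _ hlk
        have hl1 : 1 ≤ l (k+1) := hKa1.trans hlk
        have hl0 : (0:ℝ) < l (k+1) := by exact_mod_cast hl1
        rw [← hSB _ hl1, mul_comm] at h2
        have h3 : -C + a * δ ≤ bmB w r (l (k+1)) := le_of_mul_le_mul_right h2 hl0
        rw [← hSB (k+1) (by omega), mul_comm]
        gcongr
        rw [hβ]
        push_cast
        linarith
      have hex : ∃ k0, max K0 K ≤ k0 ∧
          ¬ (r (k0+1) = r k0 ∧ (r (k0+1) = 0 ∨ r (k0+1) = b - 1)) := by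
        by_contra hno
        push Not at hno
        apply hne
        have h0 := hno _ le_rfl
        refine ⟨max K0 K, ?_, ?_⟩
        · rw [← h0.1]; exact h0.2
        · intro q hq
          induction q, hq using Nat.le_induction with
          | base => rfl
          | succ q hq ih => rw [(hno q hq).1, ih]
      obtain ⟨k0, hk0, hk0b⟩ := hex
      refine ⟨k0 + 1, by omega, ?_⟩
      intro k hk
      induction k, hk using Nat.le_induction with
      | base => exact good k0 hk0 hk0b
      | succ k hk ihk =>
        by_contra hlt
        push Not at hlt
        have hwk : w (r k) < β := by
          rw [hSs] at hlt
          push_cast at hlt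
          linarith
        apply hne
        have nb : ∀ q, k ≤ q → S (q+1) < ((q+1 : ℕ):ℝ) * β →
            (r (q+1) = r q ∧ (r (q+1) = 0 ∨ r (q+1) = b - 1)) := by
          intro q hq hSq
          by_contra hb
          exact absurd (good q (by omega) hb) (not_le.2 hSq)
        have hall : ∀ q, k ≤ q → r q = r k ∧ S (q+1) < ((q+1 : ℕ):ℝ) * β := by
          intro q hq
          induction q, hq using Nat.le_induction with
          | base => exact ⟨rfl, hlt⟩
          | succ q hq ih =>
            have h1 := (nb q hq ih.2).1.trans ih.1
            refine ⟨h1, ?_⟩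
            rw [hSs, h1]
            have := ih.2
            push_cast at this ⊢
            linarith
        have hk1 := nb k le_rfl hlt
        refine ⟨k, ?_, fun q hq => (hall q hq).1⟩
        rw [← hk1.1]; exact hk1.2
  obtain ⟨a, ha⟩ := exists_nat_gt ((2 * C) / δ)
  obtain ⟨Ka, hKa1, hKa⟩ := claim a
  have h1 := hKa Ka le_rfl
  have h2 := (abs_le.1 (hSabs Ka)).2
  have h0 : (0:ℝ) < Ka := by exact_mod_cast hKa1
  rw [div_lt_iff₀ hδ] at ha
  nlinarith

/-- Good levels: all codings of points near `x` satisfy `A_k ≥ -δ`. -/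
lemma bm_good {b : ℕ} (hb : 2 ≤ b) {w : ℕ → ℝ} {r : ℕ → ℕ} (hr : ∀ q, r q < b) {x : ℝ}
    (hx : bmCode b r x) {l : ℕ → ℕ} (hl : Tendsto l atTop atTop) (hlk : ∀ k, l (k+1) ≤ k)
    {δ : ℝ} (hδ : 0 < δ) (K : ℕ) :
    ∃ k, K < k ∧ ∀ (r' : ℕ → ℕ) (z : ℝ), (∀ q, r' q < b) → bmCode b r' z →
      |z - x| * (b:ℝ) ^ (k+1) < 1 → -δ ≤ bmB w r' (l k) - bmB w r' k := by
  obtain ⟨C, hC⟩ : ∃ C, ∀ a < b, |w a| ≤ C := by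
    refine ⟨∑ a ∈ Finset.range b, |w a|, fun a ha => ?_⟩
    exact Finset.single_le_sum (f := fun a => |w a|) (fun _ _ => abs_nonneg _)
      (Finset.mem_range.2 ha)
  by_cases hne : ∃ s, (r s = 0 ∨ r s = b - 1) ∧ ∀ q, s ≤ q → r q = r s
  · obtain ⟨s, _, hs⟩ := hne
    have t1 : Tendsto (fun k : ℕ => (2 * s * C) / (l k : ℝ)) atTop (𝓝 0) :=
      (tendsto_const_div_atTop_nhds_zero_nat (2 * s * C)).comp hl
    have t2 : Tendsto (fun k : ℕ => (2 * s * C) / (k : ℝ)) atTop (𝓝 0) :=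
      tendsto_const_div_atTop_nhds_zero_nat (2 * s * C)
    have e1 := t1.eventually_lt_const (half_pos hδ)
    have e2 := t2.eventually_lt_const (half_pos hδ)
    obtain ⟨k, h1, h2, h3, h4⟩ :=
      (e1.and (e2.and ((hl.eventually_ge_atTop 1).and (eventually_gt_atTop K)))).exists
    refine ⟨k, h4, ?_⟩
    intro r' z hr' hz hnear
    obtain ⟨c, hcb, hc⟩ := bm_const_agree hb hr hr' hx hz s hs k hnear
    have hlk' : l k ≤ k := by
      obtain ⟨k', rfl⟩ : ∃ k', k = k' + 1 := ⟨k - 1, by omega⟩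
      exact (hlk k').trans (by omega)
    have b1 := bm_B_const (w := w) (fun q => hC _ (hr' q)) (hC c hcb) h3
      (fun q h h' => hc q h (by omega))
    have b2 := bm_B_const (w := w) (fun q => hC _ (hr' q)) (hC c hcb) (by omega : 1 ≤ k)
      (fun q h h' => hc q h h')
    have b1' := (abs_le.1 b1).1
    have b2' := (abs_le.1 b2).2
    linarith
  · have t2 : Tendsto (fun k : ℕ => (2 * C) / (k : ℝ)) atTop (𝓝 0) :=
      tendsto_const_div_atTop_nhds_zero_nat (2 * C)
    obtain ⟨K1, hK1⟩ := eventually_atTop.1 (t2.eventually_lt_const (half_pos hδ))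
    obtain ⟨k, hk, hbr, hA⟩ := bm_break (w := w) (fun q => hC _ (hr q)) hl (half_pos hδ) hne
      (max K K1)
    refine ⟨k+1, lt_of_le_of_lt (le_max_left _ _) hk, ?_⟩
    intro r' z hr' hz hnear
    have hag := bm_break_agree hb hr hr' hx hz k hnear hbr
    have h1 : bmB w r' (l (k+1)) = bmB w r (l (k+1)) :=
      bm_B_congr fun q hq => hag q (lt_of_lt_of_le hq (hlk k))
    have h2 := bm_B_last (w := w) (fun q => hC _ (hr q)) (fun q => hC _ (hr' q)) hag
    have h3 := hK1 (k+1) (by have := le_max_right K K1; omega)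
    have h4 := (abs_le.1 h2).2
    linarith


lemma bm_sig (m n : ℕ) (hm : 2 ≤ m) (hmn : m < n) :
    0 < sig m n ∧ sig m n < 1 ∧ sig m n * Real.log n = Real.log m := by
  have hm1 : (1:ℝ) < m := by exact_mod_cast (by omega : 1 < m)
  have hmn' : (m:ℝ) < n := by exact_mod_cast hmn
  have h1 := Real.log_pos hm1
  have h2 : Real.log m < Real.log n := Real.log_lt_log (by linarith) hmn'
  have h3 : 0 < Real.log n := h1.trans h2
  unfold sig
  exact ⟨by positivity, (div_lt_one h3).2 h2, by field_simp⟩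

lemma bm_lk_lt (m n : ℕ) (hm : 2 ≤ m) (hmn : m < n) (k : ℕ) : lk m n (k+1) ≤ k := by
  obtain ⟨h0, h1, _⟩ := bm_sig m n hm hmn
  have : lk m n (k+1) < k + 1 := by
    unfold lk
    rw [Nat.floor_lt (by positivity)]
    have : (0:ℝ) < ((k+1 : ℕ):ℝ) := by positivity
    nlinarith
  omega

lemma bm_lk_tendsto (m n : ℕ) (hm : 2 ≤ m) (hmn : m < n) : Tendsto (lk m n) atTop atTop := by
  obtain ⟨h0, h1, _⟩ := bm_sig m n hm hmn
  unfold lk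
  apply tendsto_nat_floor_atTop.comp
  exact Tendsto.const_mul_atTop h0 tendsto_natCast_atTop_atTop

lemma bm_lk_pow (m n : ℕ) (hm : 2 ≤ m) (hmn : m < n) (k : ℕ) :
    (n:ℝ) ^ lk m n k ≤ (m:ℝ) ^ k ∧ (m:ℝ) ^ k ≤ n * (n:ℝ) ^ lk m n k := by
  obtain ⟨h0, h1, h2⟩ := bm_sig m n hm hmn
  have hm0 : (0:ℝ) < m := by positivity
  have hn0 : (0:ℝ) < n := by exact_mod_cast (by omega : 0 < n)
  have hn1 : (1:ℝ) < n := by exact_mod_cast (by omega : 1 < n)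
  have hlog := Real.log_pos hn1
  have f1 : (lk m n k : ℝ) ≤ sig m n * k := Nat.floor_le (by positivity)
  have f2 : sig m n * k < lk m n k + 1 := Nat.lt_floor_add_one _
  constructor
  · rw [← Real.log_le_log_iff (by positivity) (by positivity), Real.log_pow, Real.log_pow, ← h2]
    nlinarith
  · rw [← pow_succ', ← Real.log_le_log_iff (by positivity) (by positivity), Real.log_pow,
      Real.log_pow, ← h2]
    push_cast
    nlinarith

lemma bm_code' (m n : ℕ) (hm : 2 ≤ m) (hmn : m < n)
    (D : Finset (ℕ × ℕ)) (hD : ∀ d ∈ D, d.1 < m ∧ d.2 < n)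
    (Λ : Set (ℝ × ℝ)) (hΛ : IsAttractor m n D Λ) (x : ℝ × ℝ) (hx : x ∈ Λ) :
    ∃ i : Word D, bmCode n (fun q => (i q).1.2) x.1 ∧ bmCode m (fun q => (i q).1.1) x.2 := by
  obtain ⟨i, hi⟩ := bm_code m n hm hmn D hD Λ hΛ x hx
  refine ⟨i, fun l => ?_, fun l => ?_⟩
  · obtain ⟨y, h0, h1, h⟩ := (hi l).1
    refine ⟨y, h0, h1, ?_⟩
    have e := bm_sum_eq n (by omega) (fun q => (i q).1.2) l
    have hn0 : (n:ℝ) ≠ 0 := by exact_mod_cast (by omega : n ≠ 0)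
    rw [h, e, zpow_neg, zpow_natCast]
    field_simp
  · obtain ⟨y, h0, h1, h⟩ := (hi l).2
    refine ⟨y, h0, h1, ?_⟩
    have e := bm_sum_eq m (by omega) (fun q => (i q).1.1) l
    have hn0 : (m:ℝ) ≠ 0 := by exact_mod_cast (by omega : m ≠ 0)
    rw [h, e, zpow_neg, zpow_natCast]
    field_simp

/-- Grid squares. -/
def bmSq (m n k : ℕ) (κ : ℤ × ℤ) : Set (ℝ × ℝ) :=
  {z | ((κ.1:ℝ) ≤ z.1 * (n:ℝ) ^ lk m n k ∧ z.1 * (n:ℝ) ^ lk m n k ≤ κ.1 + 1) ∧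
    ((κ.2:ℝ) ≤ z.2 * (m:ℝ) ^ k ∧ z.2 * (m:ℝ) ^ k ≤ κ.2 + 1)}

lemma bm_Icc (b : ℕ) (hb : 2 ≤ b) (r : ℕ → ℕ) (l : ℕ) (z : ℝ) :
    z ∈ Icc (∑ q ∈ Finset.range l, (r q : ℝ) * (b : ℝ) ^ (-(q + 1 : ℤ)))
      (∑ q ∈ Finset.range l, (r q : ℝ) * (b : ℝ) ^ (-(q + 1 : ℤ)) + (b:ℝ) ^ (-(l:ℤ))) ↔
    ((bmN b r l : ℝ) ≤ z * (b:ℝ)^l ∧ z * (b:ℝ)^l ≤ bmN b r l + 1) := by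
  have hb0 : (0:ℝ) < (b:ℝ)^l := by positivity
  have e : (bmN b r l:ℝ) * ((b:ℝ)^l)⁻¹ + ((b:ℝ)^l)⁻¹ = (bmN b r l + 1) / (b:ℝ)^l := by
    field_simp
  rw [bm_sum_eq b hb r l, zpow_neg, zpow_natCast, mem_Icc, e, ← div_eq_mul_inv,
    div_le_iff₀ hb0, le_div_iff₀ hb0]

lemma bm_approxSq (m n : ℕ) (hm : 2 ≤ m) (hmn : m < n) {D : Finset (ℕ × ℕ)} (k : ℕ)
    (i : Word D) : approxSq m n k i =
      bmSq m n k (bmN n (fun q => (i q).1.2) (lk m n k), bmN m (fun q => (i q).1.1) k) := by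
  ext z
  have h1 := bm_Icc n (by omega) (fun q => (i q).1.2) (lk m n k) z.1
  have h2 := bm_Icc m hm (fun q => (i q).1.1) k z.2
  rw [approxSq, mem_prod, h1, h2]
  rfl

lemma bm_offset {a a0 : ℤ} {u v : ℝ} (h1 : (a:ℝ) ≤ u) (h2 : u ≤ a + 1) (h3 : (a0:ℝ) ≤ v)
    (h4 : v ≤ a0 + 1) (h : |u - v| < 1) : a ∈ Finset.Icc (a0 - 1) (a0 + 1) := by
  rw [abs_lt] at h
  rw [Finset.mem_Icc]
  constructor
  · have : (a0:ℝ) - 2 < a := by linarith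
    have : a0 - 2 < a := by exact_mod_cast this
    omega
  · have : (a:ℝ) < a0 + 2 := by linarith
    have : a < a0 + 2 := by exact_mod_cast this
    omega

lemma bmCode_mem {b : ℕ} {r : ℕ → ℕ} {x : ℝ} (h : bmCode b r x) (l : ℕ) :
    (bmN b r l : ℝ) ≤ x * (b:ℝ)^l ∧ x * (b:ℝ)^l ≤ bmN b r l + 1 := by
  obtain ⟨y, h0, h1, e⟩ := h l
  rw [e]
  constructor <;> linarith

/-- A heavy approximate square near `x`. -/
lemma bm_heavy (m n : ℕ) (hm : 2 ≤ m) (hmn : m < n)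
    (D : Finset (ℕ × ℕ)) (hD : ∀ d ∈ D, d.1 < m ∧ d.2 < n)
    (μ : Measure (ℝ × ℝ))
    (Λ : Set (ℝ × ℝ)) (hΛ : IsAttractor m n D Λ) (hfull : μ Λᶜ = 0) (x : ℝ × ℝ) (hx : x ∈ Λ)
    (k : ℕ) (hpos : 0 < μ (ball x (1 / (m:ℝ)^(k+1)))) :
    ∃ (z : ℝ × ℝ) (j : Word D), z ∈ ball x (1 / (m:ℝ)^(k+1)) ∧
      bmCode n (fun q => (j q).1.2) z.1 ∧ bmCode m (fun q => (j q).1.1) z.2 ∧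
      μ (ball x (1 / (m:ℝ)^(k+1))) ≤ 9 * μ (approxSq m n k j) := by
  classical
  have hm0 : (0:ℝ) < m := by positivity
  have hm1 : (1:ℝ) < m := by exact_mod_cast (by omega : 1 < m)
  obtain ⟨i, hi1, hi2⟩ := bm_code' m n hm hmn D hD Λ hΛ x hx
  set a0 := bmN n (fun q => (i q).1.2) (lk m n k) with ha0
  set b0 := bmN m (fun q => (i q).1.1) k with hb0
  let F : Finset (ℤ × ℤ) := Finset.Icc (a0-1) (a0+1) ×ˢ Finset.Icc (b0-1) (b0+1)
  let P : ℤ × ℤ → Prop := fun κ => ∃ (z : ℝ × ℝ) (j : Word D), z ∈ ball x (1 / (m:ℝ)^(k+1)) ∧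
      bmCode n (fun q => (j q).1.2) z.1 ∧ bmCode m (fun q => (j q).1.1) z.2 ∧
      κ = (bmN n (fun q => (j q).1.2) (lk m n k), bmN m (fun q => (j q).1.1) k)
  let G := F.filter P
  have hcard : G.card ≤ 9 := by
    refine (Finset.card_filter_le _ _).trans ?_
    simp only [F, Finset.card_product, Int.card_Icc]
    have e1 : (a0 + 1 + 1 - (a0 - 1)).toNat = 3 := by
      have : a0 + 1 + 1 - (a0 - 1) = 3 := by ring
      rw [this]; rfl
    have e2 : (b0 + 1 + 1 - (b0 - 1)).toNat = 3 := by
      have : b0 + 1 + 1 - (b0 - 1) = 3 := by ring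
      rw [this]; rfl
    rw [e1, e2]
  have hsub : ball x (1 / (m:ℝ)^(k+1)) ⊆ (⋃ κ ∈ G, bmSq m n k κ) ∪ Λᶜ := by
    intro z hz
    by_cases hzΛ : z ∈ Λ
    · left
      obtain ⟨j, hj1, hj2⟩ := bm_code' m n hm hmn D hD Λ hΛ z hzΛ
      simp only [mem_iUnion]
      refine ⟨(bmN n (fun q => (j q).1.2) (lk m n k), bmN m (fun q => (j q).1.1) k), ?_, ?_⟩
      · rw [Finset.mem_filter]
        refine ⟨?_, z, j, hz, hj1, hj2, rfl⟩
        have hz' := hz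
        rw [mem_ball, Prod.dist_eq, max_lt_iff, Real.dist_eq, Real.dist_eq] at hz'
        have hlp := (bm_lk_pow m n hm hmn k).1
        have hnp : (0:ℝ) < (n:ℝ) ^ lk m n k := by
          have : (0:ℝ) < n := by exact_mod_cast (by omega : 0 < n)
          positivity
        have hmk : (0:ℝ) < (m:ℝ)^k := by positivity
        have gen : ∀ u v c : ℝ, 0 < c → c ≤ (m:ℝ)^k → |u - v| < 1 / (m:ℝ)^(k+1) →
            |u * c - v * c| < 1 := by
          intro u v c hc hc' huv
          rw [← sub_mul, abs_mul, abs_of_pos hc]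
          calc |u - v| * c < 1 / (m:ℝ)^(k+1) * c := by gcongr
            _ ≤ 1 / (m:ℝ)^(k+1) * (m:ℝ)^k := by gcongr
            _ = 1 / m := by rw [pow_succ]; field_simp
            _ ≤ 1 := by rw [div_le_one hm0]; exact hm1.le
        rw [Finset.mem_product]
        constructor
        · exact bm_offset (bmCode_mem hj1 _).1 (bmCode_mem hj1 _).2 (bmCode_mem hi1 _).1
            (bmCode_mem hi1 _).2 (gen _ _ _ hnp hlp hz'.1)
        · exact bm_offset (bmCode_mem hj2 _).1 (bmCode_mem hj2 _).2 (bmCode_mem hi2 _).1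
            (bmCode_mem hi2 _).2 (gen _ _ _ hmk le_rfl hz'.2)
      · exact ⟨bmCode_mem hj1 _, bmCode_mem hj2 _⟩
    · right; exact hzΛ
  have hle : μ (ball x (1 / (m:ℝ)^(k+1))) ≤ ∑ κ ∈ G, μ (bmSq m n k κ) := by
    calc _ ≤ μ ((⋃ κ ∈ G, bmSq m n k κ) ∪ Λᶜ) := measure_mono hsub
      _ ≤ μ (⋃ κ ∈ G, bmSq m n k κ) + μ Λᶜ := measure_union_le _ _
      _ = μ (⋃ κ ∈ G, bmSq m n k κ) := by rw [hfull, add_zero]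
      _ ≤ _ := measure_biUnion_finset_le _ _
  have hGne : G.Nonempty := by
    rw [Finset.nonempty_iff_ne_empty]
    intro h
    rw [h, Finset.sum_empty] at hle
    exact absurd hpos (not_lt.2 hle)
  obtain ⟨κ, hκ, hmax⟩ := G.exists_max_image (fun κ => μ (bmSq m n k κ)) hGne
  obtain ⟨z, j, hz, hj1, hj2, rfl⟩ := (Finset.mem_filter.1 hκ).2
  refine ⟨z, j, hz, hj1, hj2, hle.trans ?_⟩
  rw [bm_approxSq m n hm hmn]
  refine (Finset.sum_le_card_nsmul _ _ _ hmax).trans ?_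
  rw [nsmul_eq_mul]
  gcongr
  exact_mod_cast hcard

lemma bm_hat (n : ℕ) (hn : 2 ≤ n) (b : ℕ) (hb : 2 ≤ b) (r : ℕ → ℕ) (l : ℕ) (z x : ℝ)
    (hz : bmCode b r z) (h : |z - x| ≤ (b:ℝ) ^ (-(l:ℤ)) / 2) :
    x ∈ Icc (∑ q ∈ Finset.range l, (r q : ℝ) * (b : ℝ) ^ (-(q + 1 : ℤ)) +
        (b : ℝ) ^ (-(l : ℤ)) / 2 - D1 n * (b : ℝ) ^ (-(l : ℤ)))
      (∑ q ∈ Finset.range l, (r q : ℝ) * (b : ℝ) ^ (-(q + 1 : ℤ)) +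
        (b : ℝ) ^ (-(l : ℤ)) / 2 + D1 n * (b : ℝ) ^ (-(l : ℤ))) := by
  have hz' := (bm_Icc b hb r l z).2 (bmCode_mem hz l)
  have hD1 : 1 ≤ D1 n := by
    unfold D1
    rw [Real.one_le_sqrt]
    have : (0:ℝ) ≤ (n:ℝ)^2 := by positivity
    linarith
  have hpos : (0:ℝ) < (b:ℝ) ^ (-(l:ℤ)) := by
    have : (0:ℝ) < b := by positivity
    positivity
  rw [mem_Icc] at hz' ⊢
  rw [abs_le] at h
  constructor <;> nlinarith [hz'.1, hz'.2, h.1, h.2]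


lemma bm_sq_ball (m n : ℕ) (hm : 2 ≤ m) (hmn : m < n) {D : Finset (ℕ × ℕ)} (k : ℕ)
    (j : Word D) (x z : ℝ × ℝ) (hz : z ∈ ball x (1 / (m:ℝ)^(k+1)))
    (hj1 : bmCode n (fun q => (j q).1.2) z.1) (hj2 : bmCode m (fun q => (j q).1.1) z.2) :
    approxSq m n k j ⊆ ball x (2 * n / (m:ℝ)^k) := by
  have hm0 : (0:ℝ) < m := by positivity
  have hm1 : (1:ℝ) < m := by exact_mod_cast (by omega : 1 < m)
  have hn2 : (1:ℝ) < n := by exact_mod_cast (by omega : 1 < n)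
  have hmk : (0:ℝ) < (m:ℝ)^k := by positivity
  have hnp : (0:ℝ) < (n:ℝ) ^ lk m n k := by positivity
  have hlp := (bm_lk_pow m n hm hmn k).2
  intro y hy
  rw [bm_approxSq m n hm hmn] at hy
  obtain ⟨⟨a1, a2⟩, a3, a4⟩ := hy
  simp only at a1 a2 a3 a4
  obtain ⟨b1, b2⟩ := bmCode_mem hj1 (lk m n k)
  obtain ⟨b3, b4⟩ := bmCode_mem hj2 k
  have gen : ∀ u v c : ℝ, 0 < c → |u * c - v * c| ≤ 1 → |u - v| ≤ 1 / c := by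
    intro u v c hc h
    rw [← sub_mul, abs_mul, abs_of_pos hc] at h
    rwa [le_div_iff₀ hc]
  have c1 := gen y.1 z.1 _ hnp (by rw [abs_le]; constructor <;> linarith)
  have c2 := gen y.2 z.2 _ hmk (by rw [abs_le]; constructor <;> linarith)
  have c3 : 1 / (n:ℝ) ^ lk m n k ≤ n / (m:ℝ)^k := by
    rw [div_le_div_iff₀ hnp hmk]; linarith
  have c4 : 1 / (m:ℝ)^k ≤ n / (m:ℝ)^k := by gcongr
  have c5 : 1 / (m:ℝ)^(k+1) ≤ n / (m:ℝ)^k := by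
    refine le_trans ?_ c4
    gcongr
    · exact hm1.le
    · omega
  have e : 2 * (n:ℝ) / (m:ℝ)^k = n / (m:ℝ)^k + n / (m:ℝ)^k := by ring
  rw [mem_ball, Prod.dist_eq, max_lt_iff, Real.dist_eq, Real.dist_eq] at hz ⊢
  rw [e]
  constructor
  · have := abs_sub_le y.1 z.1 x.1
    linarith [hz.1]
  · have := abs_sub_le y.2 z.2 x.2
    linarith [hz.2]

theorem covering_by_hat_rectangles
    (m n : ℕ) (hm : 2 ≤ m) (hmn : m < n)
    (D : Finset (ℕ × ℕ)) (hD : ∀ d ∈ D, d.1 < m ∧ d.2 < n)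
    (hrow : ∃ d ∈ D, ∃ d' ∈ D, d.1 ≠ d'.1)
    (hcol : ∃ d ∈ D, ∃ d' ∈ D, d.2 ≠ d'.2)
    (p : ℕ × ℕ → ℝ) (hp : ∀ d ∈ D, 0 < p d) (hp1 : ∑ d ∈ D, p d = 1)
    (μ : Measure (ℝ × ℝ)) (hμ1 : IsProbabilityMeasure μ) (hμ : IsSelfAffine m n D p μ)
    (Λ : Set (ℝ × ℝ)) (hΛ : IsAttractor m n D Λ)

    (t : ℝ) :
    ∀ (α ε : ℝ), 0 < ε → ∀ K : ℕ,
      levelSet μ Λ α ⊆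
        ⋃ (k : ℕ) (_ : K < k) (i : Word D) (_ : MemG m n μ p t α ε k i),
          hatRect m n k i := by
  intro α ε hε K x hx
  have hfull := bm_full m n hm hmn D p hp hp1 μ hμ1 hμ Λ hΛ
  obtain ⟨hxΛ, hloc⟩ := hx
  have hα : 0 < α := bm_alpha_pos m n hm hmn D hD hrow p hp hp1 μ hμ1 hμ Λ hΛ x hxΛ α hloc
  obtain ⟨i, hi1, hi2⟩ := bm_code' m n hm hmn D hD Λ hΛ x hxΛ
  have hm0 : (0:ℝ) < m := by positivity
  have hm1 : (1:ℝ) < m := by exact_mod_cast (by omega : 1 < m)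
  have hm2 : (2:ℝ) ≤ m := by exact_mod_cast hm
  have hn2 : (1:ℝ) < n := by exact_mod_cast (by omega : 1 < n)
  have hn0 : (0:ℝ) < n := by linarith
  set L := Real.log m with hL
  have hLpos : 0 < L := Real.log_pos hm1
  have hδ : 0 < Real.log (1 + ε) := Real.log_pos (by linarith)
  have hpow : Tendsto (fun k : ℕ => (m:ℝ)^k) atTop atTop := tendsto_pow_atTop_atTop_of_one_lt hm1
  have t2 : Tendsto (fun k : ℕ => 2 * (n:ℝ) / (m:ℝ)^k) atTop (𝓝[>] 0) := by
    rw [tendsto_nhdsWithin_iff]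
    exact ⟨hpow.const_div_atTop _, Eventually.of_forall fun k => by
      show (0:ℝ) < _
      positivity⟩
  have t1 : Tendsto (fun k : ℕ => 1 / (m:ℝ)^(k+1)) atTop (𝓝[>] 0) := by
    rw [tendsto_nhdsWithin_iff]
    refine ⟨(hpow.const_div_atTop 1).comp (tendsto_add_atTop_nat 1), Eventually.of_forall fun k => ?_⟩
    show (0:ℝ) < _
    positivity
  have e1 := (hloc.comp t1).eventually_lt_const (show α < α * (1 + ε/2) by nlinarith)
  have e2 := (hloc.comp t2).eventually_const_lt (show α * (1 - ε/2) < α by nlinarith)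
  have tk : Tendsto (fun k : ℕ => (k:ℝ) * (α * ε * L / 2)) atTop atTop :=
    tendsto_natCast_atTop_atTop.atTop_mul_const (by positivity)
  have tk' : Tendsto (fun k : ℕ => (k:ℝ) * L) atTop atTop :=
    tendsto_natCast_atTop_atTop.atTop_mul_const (by positivity)
  have e3 := tk.eventually_ge_atTop (α * (1 + ε/2) * L + Real.log 9)
  have e4 := tk.eventually_ge_atTop (α * (1 - ε/2) * Real.log (2 * n))
  have e5 := tk'.eventually_gt_atTop (Real.log (2 * n))
  obtain ⟨K1, hK1⟩ := eventually_atTop.1 (e1.and (e2.and (e3.and (e4.and e5))))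
  obtain ⟨k, hk, hgood⟩ := bm_good (w := fun a => Real.log (omg D p t (a, 0))) hm
    (fun q => (hD _ (i q).2).1) hi2 (bm_lk_tendsto m n hm hmn) (bm_lk_lt m n hm hmn) hδ (max K K1)
  obtain ⟨f1, f2, f3, f4, f5⟩ := hK1 k ((le_max_right K K1).trans hk.le)
  simp only [Function.comp] at f1 f2
  have hposball : 0 < μ (ball x (1 / (m:ℝ)^(k+1))) := by
    refine lt_of_lt_of_le (bm_pos m n hm hmn D hD p hp hp1 μ hμ1 hμ Λ hΛ (k+2) x hxΛ)
      (measure_mono (closedBall_subset_ball ?_))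
    apply one_div_lt_one_div_of_lt (by positivity)
    exact pow_lt_pow_right₀ hm1 (by omega)
  obtain ⟨z, j, hz, hj1, hj2, hheavy⟩ := bm_heavy m n hm hmn D hD μ Λ hΛ hfull x hxΛ k hposball
  have hsub := bm_sq_ball m n hm hmn k j x z hz hj1 hj2
  have hz' := hz
  rw [mem_ball, Prod.dist_eq, max_lt_iff, Real.dist_eq, Real.dist_eq] at hz'
  have hmk : (0:ℝ) < (m:ℝ)^k := by positivity
  have hnp : (0:ℝ) < (n:ℝ) ^ lk m n k := by positivity
  -- the condition on `A_k`
  have hA : -Real.log (1 + ε) ≤ Ak m n p t j k := by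
    have := hgood (fun q => (j q).1.1) z.2 (fun q => (hD _ (j q).2).1) hj2
      (by rw [← lt_div_iff₀ (by positivity)]; exact hz'.2)
    exact this
  have hSpos : 0 < μ (approxSq m n k j) := by
    by_contra h
    have h0 : μ (approxSq m n k j) = 0 := by simpa using h
    rw [h0, mul_zero] at hheavy
    exact absurd hposball (not_lt.2 hheavy)
  have hreal9 : (μ (ball x (1 / (m:ℝ)^(k+1)))).toReal ≤ 9 * (μ (approxSq m n k j)).toReal := by
    have := ENNReal.toReal_mono (ENNReal.mul_ne_top (by simp) (measure_ne_top _ _)) hheavy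
    rwa [ENNReal.toReal_mul, ENNReal.toReal_ofNat] at this
  have hreal2 : (μ (approxSq m n k j)).toReal ≤ (μ (ball x (2 * n / (m:ℝ)^k))).toReal :=
    ENNReal.toReal_mono (measure_ne_top _ _) (measure_mono hsub)
  have hS0 : 0 < (μ (approxSq m n k j)).toReal :=
    ENNReal.toReal_pos hSpos.ne' (measure_ne_top _ _)
  have hB0 : 0 < (μ (ball x (1 / (m:ℝ)^(k+1)))).toReal :=
    ENNReal.toReal_pos hposball.ne' (measure_ne_top _ _)
  have hlog9 : Real.log (μ (ball x (1 / (m:ℝ)^(k+1)))).toReal ≤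
      Real.log 9 + Real.log (μ (approxSq m n k j)).toReal := by
    rw [← Real.log_mul (by norm_num) hS0.ne']
    exact Real.log_le_log hB0 hreal9
  have hlog2 := Real.log_le_log hS0 hreal2
  have r1 : Real.log (1 / (m:ℝ)^(k+1)) = -((k+1) * L) := by
    rw [one_div, Real.log_inv, Real.log_pow]; push_cast; rfl
  have r2 : Real.log (2 * n / (m:ℝ)^k) = Real.log (2 * n) - k * L := by
    rw [Real.log_div (by positivity) (by positivity), Real.log_pow]
  rw [r1, div_lt_iff_of_neg (by nlinarith [(Nat.cast_nonneg k : (0:ℝ) ≤ k)])] at f1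
  rw [r2, lt_div_iff_of_neg (by linarith)] at f2
  have hlow : ENNReal.ofReal ((m : ℝ) ^ (-((k : ℝ) * α * (1 + ε)))) ≤ μ (approxSq m n k j) := by
    rw [ENNReal.ofReal_le_iff_le_toReal (measure_ne_top _ _), Real.rpow_def_of_pos hm0,
      ← Real.le_log_iff_exp_le hS0]
    nlinarith
  have hup : μ (approxSq m n k j) ≤ ENNReal.ofReal ((m : ℝ) ^ (-((k : ℝ) * α * (1 - ε)))) := by
    rw [ENNReal.le_ofReal_iff_toReal_le (measure_ne_top _ _) (by positivity),
      Real.rpow_def_of_pos hm0, ← Real.log_le_iff_le_exp hS0]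
    nlinarith
  have hdist : 1 / (m:ℝ)^(k+1) ≤ 1 / (m:ℝ)^k / 2 := by
    rw [div_div, pow_succ]
    gcongr
  have hh1 : |z.1 - x.1| ≤ (n:ℝ) ^ (-(lk m n k:ℤ)) / 2 := by
    have h := one_div_le_one_div_of_le hnp (bm_lk_pow m n hm hmn k).1
    rw [zpow_neg, zpow_natCast, ← one_div]
    linarith [hz'.1]
  have hh2 : |z.2 - x.2| ≤ (m:ℝ) ^ (-(k:ℤ)) / 2 := by
    rw [zpow_neg, zpow_natCast, ← one_div]
    linarith [hz'.2]
  have hhat : x ∈ hatRect m n k j :=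
    ⟨bm_hat n (by omega) n (by omega) (fun q => (j q).1.2) (lk m n k) z.1 x.1 hj1 hh1,
      bm_hat n (by omega) m hm (fun q => (j q).1.1) k z.2 x.2 hj2 hh2⟩
  simp only [mem_iUnion]
  exact ⟨k, (le_max_left K K1).trans_lt hk, j, ⟨⟨hlow, hup⟩, hA⟩, hhat⟩

end BedfordMcMullen
end
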